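/- For every ε > 0 there exists a finite constant C_ε such that for every segment Λ ⊂ ℤ with |Λ| = L ≥ 2, every N ≥ 1 and every f ≥ 0, ν_Λ^N[ f , Σ_{x∈Λ} h(η_x) ]² ≤ (L²/N) ν_Λ^N[f] ( C_ε ν_Λ^N[f] + C_ε L² E_{ν_Λ^N}(√f,√f) + ε Ent_{ν_Λ^N}(f) ), where h(n) := (n+1)/c(n+1). -/

import Mathlib

open scoped BigOperators

noncomputable section

/-- `cfact c k = c(k)! = c(1)⋯c(k)`, with `cfact c 0 = 1`. -/
def cfact (c : ℕ → ℝ) : ℕ → ℝ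
  | 0 => 1
  | k + 1 => cfact c k * c (k + 1)

/-- The configuration obtained from `η` by moving one particle from `x` to `y` (`x ≠ y`),
i.e. `η - δ^x + δ^y`. -/
def move (η : ℤ → ℕ) (x y : ℤ) : ℤ → ℕ :=
  fun z => if z = x then η x - 1 else if z = y then η y + 1 else η z

/-- Unnormalized weight of the canonical measure `ν_Λ^N` on configurations supported in `Λ`
with `N` particles: `∏_{x∈Λ} 1/c(η_x)!`. -/
def nuW (c : ℕ → ℝ) (Λ : Finset ℤ) (N : ℕ) : (ℤ → ℕ) → ℝ :=
  Set.indicator {η : ℤ → ℕ | (∀ x, x ∉ Λ → η x = 0) ∧ (∑ x ∈ Λ, η x) = N}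
    (fun η => ∏ x ∈ Λ, (cfact c (η x))⁻¹)

/-- Expectation with respect to the probability measure obtained by normalizing the
nonnegative weight `w`. -/
def wE (w f : (ℤ → ℕ) → ℝ) : ℝ :=
  (∑' η : ℤ → ℕ, w η * f η) / (∑' η : ℤ → ℕ, w η)

/-- Covariance `μ[f,g] = μ[f g] - μ[f] μ[g]`. -/
def wCov (w f g : (ℤ → ℕ) → ℝ) : ℝ :=
  wE w (fun η => f η * g η) - wE w f * wE w g

/-- Entropy `Ent_μ(f) = μ[f log f] - μ[f] log μ[f]` (note `Real.log 0 = 0`, giving the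
convention `0 log 0 = 0`). -/
def wEnt (w f : (ℤ → ℕ) → ℝ) : ℝ :=
  wE w (fun η => f η * Real.log (f η)) - wE w f * Real.log (wE w f)

/-- Dirichlet form of the zero-range process on `Λ`:
`E(f,g) = (1/2) Σ_{x∈Λ} Σ_{y∈Λ, |x-y|=1} μ[c(η_x) ∂_{xy}f ∂_{xy}g]`. -/
def wDir (c : ℕ → ℝ) (Λ : Finset ℤ) (w f g : (ℤ → ℕ) → ℝ) : ℝ :=
  wE w (fun η => (1 / 2) * ∑ x ∈ Λ, ∑ y ∈ Λ,
    if |x - y| = 1 then c (η x) * ((f (move η x y) - f η) * (g (move η x y) - g η)) else 0)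

/-- Weight conditioned on the event `∑_{x ∈ Λ₁} η x = n`. -/
def condW (w : (ℤ → ℕ) → ℝ) (Λ₁ : Finset ℤ) (n : ℕ) : (ℤ → ℕ) → ℝ :=
  Set.indicator {η : ℤ → ℕ | (∑ x ∈ Λ₁, η x) = n} w

/-- `h(n) = (n+1)/c(n+1)`. -/
def hfun (c : ℕ → ℝ) (n : ℕ) : ℝ := (n + 1) / c (n + 1)


theorem cfact_pos (c : ℕ → ℝ) (hcpos : ∀ n : ℕ, 0 < n → 0 < c n) (n : ℕ) : 0 < cfact c n := by
  induction n with
  | zero => simp [cfact]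
  | succ k ih => simp only [cfact]; exact mul_pos ih (hcpos _ (Nat.succ_pos _))

/-- tail sum -/
def tl (p : ℕ → ℝ) (M : ℕ) (m : ℝ) (h : ℕ → ℝ) (n : ℕ) : ℝ :=
  ∑ k ∈ Finset.Ioc n M, p k * (h k - m)

/-- double sum -/
def dbl (p : ℕ → ℝ) (M : ℕ) (h : ℕ → ℝ) (n : ℕ) : ℝ :=
  ∑ j ∈ Finset.range (n + 1), ∑ k ∈ Finset.Ioc n M, p j * p k * (h k - h j)

theorem sum_split_range (g : ℕ → ℝ) (n M : ℕ) (hn : n ≤ M) :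
    ∑ k ∈ Finset.range (M + 1), g k =
      ∑ k ∈ Finset.range (n + 1), g k + ∑ k ∈ Finset.Ioc n M, g k := by
  have h1 : Finset.Ioc n M = Finset.Ico (n + 1) (M + 1) := by
    ext i; simp only [Finset.mem_Ioc, Finset.mem_Ico]; omega
  rw [h1, Finset.sum_range_add_sum_Ico g (by omega)]

theorem dbl_eq (p : ℕ → ℝ) (M : ℕ) (m : ℝ) (h : ℕ → ℝ) (n : ℕ) (hn : n ≤ M)
    (hm : ∑ k ∈ Finset.range (M + 1), p k * (h k - m) = 0) :
    dbl p M h n = (∑ k ∈ Finset.range (M + 1), p k) * tl p M m h n := by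
  have e : dbl p M h n = (∑ j ∈ Finset.range (n + 1), p j) * (∑ k ∈ Finset.Ioc n M, p k * (h k - m))
      - (∑ j ∈ Finset.range (n + 1), p j * (h j - m)) * (∑ k ∈ Finset.Ioc n M, p k) := by
    unfold dbl
    rw [Finset.sum_mul_sum, Finset.sum_mul_sum, ← Finset.sum_sub_distrib]
    refine Finset.sum_congr rfl fun j _ => ?_
    rw [← Finset.sum_sub_distrib]
    refine Finset.sum_congr rfl fun k _ => ?_
    ring
  rw [sum_split_range _ n M hn] at hm
  rw [sum_split_range p n M hn, e]
  have : ∑ j ∈ Finset.range (n + 1), p j * (h j - m) = - tl p M m h n := by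
    unfold tl; linarith
  rw [this]; unfold tl; ring

/-- The Stein equation. -/
theorem stein_eq (c p : ℕ → ℝ) (φ : ℝ) (hφ : 0 < φ) (hc0 : c 0 = 0) (hp : ∀ n, 0 < p n)
    (hrec : ∀ n, p (n + 1) * c (n + 1) = φ * p n)
    (M : ℕ) (m : ℝ) (h : ℕ → ℝ)
    (hm : ∑ k ∈ Finset.range (M + 1), p k * (h k - m) = 0) (n : ℕ) (hn : n ≤ M) :
    c n * (tl p M m h (n - 1) / (φ * p (n - 1))) - φ * (tl p M m h n / (φ * p n)) = h n - m := by
  have hpn := hp n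
  cases n with
  | zero =>
    rw [sum_split_range _ 0 M hn] at hm
    simp only [zero_add, Finset.sum_range_one] at hm
    have : tl p M m h 0 = - (p 0 * (h 0 - m)) := by unfold tl; linarith
    rw [hc0, this]
    field_simp
    ring
  | succ n =>
    have h1 : tl p M m h n = p (n + 1) * (h (n + 1) - m) + tl p M m h (n + 1) := by
      unfold tl
      have : Finset.Ioc n M = insert (n + 1) (Finset.Ioc (n + 1) M) := by
        ext i; simp only [Finset.mem_Ioc, Finset.mem_insert]; omega
      rw [this, Finset.sum_insert (by simp)]
    have hr := hrec n
    simp only [Nat.add_sub_cancel]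
    rw [← hr, h1]
    have hcn : c (n + 1) ≠ 0 := by
      intro h0; rw [h0] at hr; have := mul_pos hφ (hp n); linarith
    field_simp
    ring

theorem dbl_mono (p : ℕ → ℝ) (hp : ∀ n, 0 < p n) (M : ℕ) (g h : ℕ → ℝ) (n : ℕ)
    (H : ∀ j k, j ≤ n → n < k → g k - g j ≤ h k - h j) : dbl p M g n ≤ dbl p M h n := by
  unfold dbl
  refine Finset.sum_le_sum fun j hj => Finset.sum_le_sum fun k hk => ?_
  have := (mul_pos (hp j) (hp k)).le
  apply mul_le_mul_of_nonneg_left _ this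
  apply H
  · simp at hj; omega
  · simp at hk; omega

theorem dbl_smul (p : ℕ → ℝ) (M : ℕ) (a : ℝ) (g : ℕ → ℝ) (n : ℕ) :
    dbl p M (fun k => a * g k) n = a * dbl p M g n := by
  unfold dbl
  simp_rw [Finset.mul_sum]
  refine Finset.sum_congr rfl fun j _ => Finset.sum_congr rfl fun k _ => ?_
  ring

theorem dbl_c (c p : ℕ → ℝ) (φ : ℝ) (hc0 : c 0 = 0)
    (hrec : ∀ n, p (n + 1) * c (n + 1) = φ * p n)
    (M n : ℕ) (hn : n ≤ M) :
    dbl p M c n = φ * (p n * (∑ k ∈ Finset.range (M + 1), p k)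
      - p M * ∑ k ∈ Finset.range (n + 1), p k) := by
  have e : dbl p M c n = (∑ j ∈ Finset.range (n + 1), p j) * (∑ k ∈ Finset.Ioc n M, p k * c k)
      - (∑ j ∈ Finset.range (n + 1), p j * c j) * (∑ k ∈ Finset.Ioc n M, p k) := by
    unfold dbl
    rw [Finset.sum_mul_sum, Finset.sum_mul_sum, ← Finset.sum_sub_distrib]
    refine Finset.sum_congr rfl fun j _ => ?_
    rw [← Finset.sum_sub_distrib]
    refine Finset.sum_congr rfl fun k _ => ?_
    ring
  have key : ∀ q, ∑ j ∈ Finset.range (q + 1), p j * c j = φ * (∑ j ∈ Finset.range (q + 1), p j - p q) := by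
    intro q
    rw [Finset.sum_range_succ', hc0, Finset.sum_range_succ]
    simp only [hrec]
    ring_nf
    rw [Finset.mul_sum]
  have k1 := key M
  have k2 := key n
  rw [sum_split_range _ n M hn] at k1
  rw [sum_split_range p n M hn] at k1 ⊢
  have k3 : ∑ k ∈ Finset.Ioc n M, p k * c k = φ * (∑ k ∈ Finset.Ioc n M, p k + p n - p M) := by
    rw [k2] at k1; linarith
  rw [e, k2, k3]
  ring

theorem p_up (c p : ℕ → ℝ) (φ r : ℝ) (hp : ∀ n, 0 < p n)
    (hrec : ∀ n, p (n + 1) * c (n + 1) = φ * p n) (hcpos : ∀ n : ℕ, 0 < n → 0 < c n) (hr : 0 ≤ r)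
    (n : ℕ) (H : ∀ i, n < i → φ ≤ r * c i) (d : ℕ) : p (n + d) ≤ r ^ d * p n := by
  induction d with
  | zero => simp
  | succ d ih =>
    have h1 := hrec (n + d)
    have h2 := H (n + d + 1) (by omega)
    have h3 := hcpos (n + d + 1) (by omega)
    have h4 : p (n + d + 1) ≤ r * p (n + d) := by
      have := mul_le_mul_of_nonneg_right h2 (hp (n + d)).le
      rw [← h1] at this
      by_contra hh
      push Not at hh
      have := mul_lt_mul_of_pos_right hh h3
      linarith
    calc p (n + (d + 1)) ≤ r * p (n + d) := h4
      _ ≤ r * (r ^ d * p n) := by gcongr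
      _ = _ := by ring

theorem p_down (c p : ℕ → ℝ) (φ r : ℝ) (hφ : 0 < φ) (hp : ∀ n, 0 < p n)
    (hrec : ∀ n, p (n + 1) * c (n + 1) = φ * p n) (hr : 0 ≤ r)
    (n : ℕ) (d : ℕ) (H : ∀ i, i ≤ n + d → c i ≤ r * φ) : p n ≤ r ^ d * p (n + d) := by
  induction d with
  | zero => simp
  | succ d ih =>
    have h1 := hrec (n + d)
    have h2 := H (n + d + 1) (by omega)
    have h4 : p (n + d) ≤ r * p (n + d + 1) := by
      have := mul_le_mul_of_nonneg_left h2 (hp (n + d + 1)).le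
      rw [h1] at this
      by_contra hh
      push Not at hh
      have := mul_lt_mul_of_pos_left hh hφ
      linarith
    calc p n ≤ r ^ d * p (n + d) := ih (fun i hi => H i (by omega))
      _ ≤ r ^ d * (r * p (n + d + 1)) := by gcongr
      _ = _ := by rw [← add_assoc]; ring

theorem c_le (c : ℕ → ℝ) (a₁ : ℝ) (hLG : ∀ k : ℕ, |c (k + 1) - c k| ≤ a₁)
    (j d : ℕ) : |c (j + d) - c j| ≤ a₁ * d := by
  induction d with
  | zero => simp
  | succ d ih =>
    have := hLG (j + d)
    rw [abs_le] at *
    rw [← add_assoc]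
    push_cast
    constructor <;> nlinarith

theorem c_ge_block (c : ℕ → ℝ) (a₂ : ℝ) (k₀ : ℕ) (hk₀ : 0 < k₀) (ha₂ : 0 < a₂)
    (hM : ∀ j k : ℕ, j + k₀ ≤ k → a₂ ≤ c k - c j) (j k : ℕ) (hjk : j + k₀ ≤ k) :
    ((k : ℝ) - j) ≤ (2 * k₀ / a₂) * (c k - c j) := by
  have h1 : ∀ q : ℕ, ∀ k, j + (q + 1) * k₀ ≤ k → a₂ * (q + 1) ≤ c k - c j := by
    intro q
    induction q with
    | zero => intro k hk; simpa using hM j k (by simpa using hk)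
    | succ q ih =>
      intro k hk
      have e1 := ih (j + (q + 1) * k₀) le_rfl
      have e2 := hM (j + (q + 1) * k₀) k (by ring_nf at hk ⊢; omega)
      push_cast
      linarith
  obtain ⟨d, rfl⟩ := Nat.exists_eq_add_of_le hjk
  have hA := Nat.div_mul_le_self d k₀
  have hB := Nat.lt_div_mul_add hk₀ (a := d)
  generalize d / k₀ = q at hA hB
  have h2 := h1 q (j + k₀ + d) (by nlinarith)
  have h3 : (d : ℝ) ≤ (q + 1) * k₀ := by
    have : d ≤ (q + 1) * k₀ := by nlinarith
    exact_mod_cast this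
  have hk : (0:ℝ) < k₀ := by exact_mod_cast hk₀
  push_cast
  calc ((j : ℝ) + k₀ + d - j) ≤ 2 * k₀ * (q + 1) := by
        have : (0:ℝ) ≤ q := by positivity
        nlinarith
    _ = (2 * k₀ / a₂) * (a₂ * (q + 1)) := by field_simp
    _ ≤ _ := by gcongr

theorem c_lower (c : ℕ → ℝ) (a₂ : ℝ) (k₀ : ℕ) (hc0 : c 0 = 0) (hcpos : ∀ n : ℕ, 0 < n → 0 < c n)
    (hk₀ : 0 < k₀) (ha₂ : 0 < a₂)
    (hM : ∀ j k : ℕ, j + k₀ ≤ k → a₂ ≤ c k - c j) : ∃ a : ℝ, 0 < a ∧ ∀ n : ℕ, a * n ≤ c n := by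
  have hk : (0:ℝ) < k₀ := by exact_mod_cast hk₀
  have small : ∀ K : ℕ, ∃ b : ℝ, 0 < b ∧ ∀ n : ℕ, n < K → b * n ≤ c n := by
    intro K
    induction K with
    | zero => exact ⟨1, one_pos, by simp⟩
    | succ K ih =>
      obtain ⟨b, hb, H⟩ := ih
      rcases Nat.eq_zero_or_pos K with h | h
      · refine ⟨1, one_pos, fun n hn => ?_⟩
        have : n = 0 := by omega
        simp [this, hc0]
      · have hK : (0:ℝ) < K := by exact_mod_cast h
        refine ⟨min b (c K / K), lt_min hb (div_pos (hcpos K h) hK), fun n hn => ?_⟩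
        rcases Nat.lt_succ_iff_lt_or_eq.mp hn with h1 | h1
        · exact le_trans (by gcongr; exact min_le_left _ _) (H n h1)
        · subst h1
          calc _ ≤ c n / n * n := by gcongr; exact min_le_right _ _
            _ = c n := by field_simp
  obtain ⟨b, hb, H⟩ := small k₀
  refine ⟨min b (a₂ / (2 * k₀)), lt_min hb (by positivity), fun n => ?_⟩
  by_cases hn : n < k₀
  · exact le_trans (by gcongr; exact min_le_left _ _) (H n hn)
  · have := c_ge_block c a₂ k₀ hk₀ ha₂ hM 0 n (by omega)
    rw [hc0] at this
    simp only [Nat.cast_zero, sub_zero] at this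
    calc _ ≤ a₂ / (2 * k₀) * n := by gcongr; exact min_le_right _ _
      _ ≤ a₂ / (2 * k₀) * (2 * k₀ / a₂ * c n) := by gcongr
      _ = c n := by field_simp


theorem near_pair (c p : ℕ → ℝ) (φ a a₁ : ℝ) (k₀ : ℕ) (hφ : 0 < φ) (ha : 0 < a)
    (haa : a ≤ a₁)
    (hp : ∀ n, 0 < p n) (hcpos : ∀ n : ℕ, 0 < n → 0 < c n)
    (hrec : ∀ n, p (n + 1) * c (n + 1) = φ * p n)
    (hlow : ∀ n : ℕ, a * n ≤ c n) (hup : ∀ n : ℕ, c n ≤ a₁ * n)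
    (M n j k : ℕ) (hj : j ≤ n) (hk : n < k) (hkM : k ≤ M) (hkk : k < n + k₀) :
    p j * p k ≤ ((1 / a + 1) ^ k₀ + 1 + (a₁ / a) ^ k₀) *
      (φ * p n * ∑ i ∈ Finset.range (M + 1), p i) := by
  set Z := ∑ i ∈ Finset.range (M + 1), p i with hZ
  have hpZ : ∀ i ≤ M, p i ≤ Z := fun i hi =>
    Finset.single_le_sum (f := p) (fun i _ => (hp i).le) (by simp; omega)
  have ha₁ : 0 < a₁ := lt_of_lt_of_le ha haa
  have hZ0 : 0 < Z := lt_of_lt_of_le (hp 0) (hpZ 0 (by omega))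
  have hjZ := hpZ j (by omega)
  have hkZ := hpZ k hkM
  have hpn := hp n
  have hpj := hp j
  have hpk := hp k
  have t1 : 0 ≤ (1 / a + 1) ^ k₀ := by positivity
  have t2 : 0 ≤ (a₁ / a) ^ k₀ := by positivity
  have hX : 0 ≤ φ * p n * Z := by positivity
  obtain ⟨d, rfl⟩ := Nat.exists_eq_add_of_lt hk
  rcases le_total φ 1 with h1 | h1
  · have e := p_up c p φ (φ / a) hp hrec hcpos (by positivity) n (fun i hi => by
      have : (1:ℝ) ≤ i := by exact_mod_cast (by omega : 1 ≤ i)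
      have h2 := hlow i
      calc φ = φ / a * (a * 1) := by field_simp
        _ ≤ φ / a * (a * i) := by gcongr
        _ ≤ _ := by gcongr) (d + 1)
    have e2 : (φ / a) ^ (d + 1) ≤ φ * (1 / a + 1) ^ k₀ := by
      have : (φ / a) ^ (d + 1) = φ ^ (d + 1) * (1 / a) ^ (d + 1) := by rw [← mul_pow]; ring
      rw [this]
      have q1 : φ ^ (d + 1) ≤ φ := by
        rw [pow_succ]; exact mul_le_of_le_one_left hφ.le (pow_le_one₀ hφ.le h1)
      have q2 : (1 / a) ^ (d + 1) ≤ (1 / a + 1) ^ k₀ := by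
        calc (1 / a) ^ (d + 1) ≤ (1 / a + 1) ^ (d + 1) := by gcongr; linarith
          _ ≤ _ := pow_le_pow_right₀ (by have : 0 < 1 / a := by positivity
                                         linarith) (by omega)
      gcongr
    calc p j * p (n + d + 1) ≤ Z * ((φ / a) ^ (d + 1) * p n) := by
          have := e; rw [← add_assoc] at this; gcongr
      _ ≤ Z * ((φ * (1 / a + 1) ^ k₀) * p n) := by gcongr
      _ = (1 / a + 1) ^ k₀ * (φ * p n * Z) := by ring
      _ ≤ _ := by gcongr; linarith
  · rcases le_total (a₁ * n) φ with h2 | h2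
    · obtain ⟨r, rfl⟩ := Nat.exists_eq_add_of_le hj
      have e := p_down c p φ 1 hφ hp hrec (by norm_num) j r (fun i hi => by
        have : (i:ℝ) ≤ ((j + r : ℕ) : ℝ) := by exact_mod_cast hi
        calc c i ≤ a₁ * i := hup i
          _ ≤ a₁ * ((j + r : ℕ) : ℝ) := by gcongr
          _ ≤ 1 * φ := by linarith)
      rw [one_pow, one_mul] at e
      calc p j * p (j + r + d + 1) ≤ p (j + r) * Z := by gcongr
        _ = 1 * (1 * p (j + r) * Z) := by ring
        _ ≤ 1 * (φ * p (j + r) * Z) := by gcongr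
        _ ≤ _ := by gcongr; linarith
    · have e := p_up c p φ (a₁ / a) hp hrec hcpos (by positivity) n (fun i hi => by
        have : (n:ℝ) ≤ i := by exact_mod_cast (by omega : n ≤ i)
        have h3 := hlow i
        calc φ ≤ a₁ * n := h2
          _ ≤ a₁ * i := by gcongr
          _ = a₁ / a * (a * i) := by field_simp
          _ ≤ _ := by gcongr) (d + 1)
      have e2 : (a₁ / a) ^ (d + 1) ≤ (a₁ / a) ^ k₀ :=
        pow_le_pow_right₀ (by rw [le_div_iff₀ ha]; linarith) (by omega)
      calc p j * p (n + d + 1) ≤ Z * ((a₁ / a) ^ k₀ * p n) := by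
            have := e; rw [← add_assoc] at this
            have := this.trans (mul_le_mul_of_nonneg_right e2 hpn.le)
            gcongr
        _ = (a₁ / a) ^ k₀ * (1 * p n * Z) := by ring
        _ ≤ (a₁ / a) ^ k₀ * (φ * p n * Z) := by gcongr
        _ ≤ _ := by gcongr; linarith

theorem dbl_id_upper (c : ℕ → ℝ) (a a₁ a₂ : ℝ) (k₀ : ℕ) (hc0 : c 0 = 0) (ha : 0 < a)
    (haa : a ≤ a₁) (hcpos : ∀ n : ℕ, 0 < n → 0 < c n)
    (hlow : ∀ n : ℕ, a * n ≤ c n)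
    (hLG : ∀ k : ℕ, |c (k + 1) - c k| ≤ a₁)
    (hk₀ : 0 < k₀) (ha₂ : 0 < a₂)
    (hM : ∀ j k : ℕ, j + k₀ ≤ k → a₂ ≤ c k - c j) :
    ∃ C : ℝ, 0 < C ∧ ∀ (p : ℕ → ℝ) (φ : ℝ), 0 < φ → (∀ n, 0 < p n) →
      (∀ n, p (n + 1) * c (n + 1) = φ * p n) → ∀ M n : ℕ, n ≤ M →
      dbl p M (fun k => (k : ℝ)) n ≤ C * (φ * p n * ∑ i ∈ Finset.range (M + 1), p i) := by
  have ha₁ : 0 < a₁ := lt_of_lt_of_le ha haa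
  have hk : (0:ℝ) < k₀ := by exact_mod_cast hk₀
  have hup : ∀ n : ℕ, c n ≤ a₁ * n := fun n => by
    have := c_le c a₁ hLG 0 n
    rw [hc0, zero_add, sub_zero] at this
    exact (abs_le.mp this).2
  set Q := ((1 / a + 1) ^ k₀ + 1 + (a₁ / a) ^ k₀) with hQ
  have hQ0 : 0 < Q := by positivity
  set α := 2 * k₀ / a₂ with hα
  have hα0 : 0 < α := by positivity
  set β := k₀ + α * (a₁ * k₀) with hβ
  have hβ0 : 0 < β := by positivity
  refine ⟨α + k₀ * (k₀ * (β * Q)), by positivity, fun p φ hφ hp hrec M n hn => ?_⟩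
  set Z := ∑ i ∈ Finset.range (M + 1), p i with hZ
  have hZ0 : 0 < Z := Finset.sum_pos (fun i _ => hp i) (by simp)
  set X := φ * p n * Z with hX
  have hX0 : 0 < X := by have := hp n; positivity
  have pw : ∀ j ∈ Finset.range (n + 1), ∀ k ∈ Finset.Ioc n M,
      p j * p k * ((k : ℝ) - j) ≤ α * (p j * p k * (c k - c j)) +
        (if n < j + k₀ then (if k < n + k₀ then β * Q * X else 0) else 0) := by
    intro j hj k hk'
    simp only [Finset.mem_range, Finset.mem_Ioc] at hj hk'
    have hpp := mul_pos (hp j) (hp k)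
    have hnn : 0 ≤ (if n < j + k₀ then (if k < n + k₀ then β * Q * X else 0) else 0) := by
      split_ifs <;> positivity
    by_cases h : j + k₀ ≤ k
    · have := c_ge_block c a₂ k₀ hk₀ ha₂ hM j k h
      nlinarith
    · rw [if_pos (by omega), if_pos (by omega)]
      have np := near_pair c p φ a a₁ k₀ hφ ha haa hp hcpos hrec hlow hup M n j k (by omega)
        (by omega) (by omega) (by omega)
      obtain ⟨d, rfl⟩ := Nat.exists_eq_add_of_lt (show j < k by omega)
      have h1 := c_le c a₁ hLG j (d + 1)
      have hd : ((d + 1 : ℕ) : ℝ) ≤ k₀ := by exact_mod_cast (by omega : d + 1 ≤ k₀)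
      have h2 := (abs_le.mp h1).1
      have h3 : ((j + d + 1 : ℕ) : ℝ) - j ≤ α * (c (j + d + 1) - c j) + β := by
        rw [← add_assoc] at h2
        have h4 : -(a₁ * k₀) ≤ c (j + d + 1) - c j := by
          have := mul_le_mul_of_nonneg_left hd ha₁.le
          linarith
        have h5 := mul_le_mul_of_nonneg_left h4 hα0.le
        push_cast at hd ⊢
        rw [hβ]
        linarith
      calc p j * p (j + d + 1) * (((j + d + 1 : ℕ) : ℝ) - j)
          ≤ p j * p (j + d + 1) * (α * (c (j + d + 1) - c j) + β) := by gcongr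
        _ = α * (p j * p (j + d + 1) * (c (j + d + 1) - c j)) + β * (p j * p (j + d + 1)) := by ring
        _ ≤ α * (p j * p (j + d + 1) * (c (j + d + 1) - c j)) + β * (Q * X) := by gcongr
        _ = _ := by ring
  have step : dbl p M (fun k => (k : ℝ)) n ≤ α * dbl p M c n +
      ∑ j ∈ Finset.range (n + 1), ∑ k ∈ Finset.Ioc n M,
        (if n < j + k₀ then (if k < n + k₀ then β * Q * X else 0) else 0) := by
    unfold dbl
    rw [Finset.mul_sum, ← Finset.sum_add_distrib]
    refine Finset.sum_le_sum fun j hj => ?_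
    rw [Finset.mul_sum, ← Finset.sum_add_distrib]
    exact Finset.sum_le_sum fun k hk' => pw j hj k hk'
  have inner : ∑ k ∈ Finset.Ioc n M, (if k < n + k₀ then β * Q * X else 0) ≤ k₀ * (β * Q * X) := by
    rw [← Finset.sum_filter, Finset.sum_const, nsmul_eq_mul]
    gcongr
    calc _ ≤ (Finset.Ioc n (n + k₀)).card := Finset.card_le_card (fun i hi => by
            simp only [Finset.mem_filter, Finset.mem_Ioc] at *; omega)
      _ = k₀ := by simp
  have outer : ∑ j ∈ Finset.range (n + 1), ∑ k ∈ Finset.Ioc n M,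
        (if n < j + k₀ then (if k < n + k₀ then β * Q * X else 0) else 0)
        ≤ k₀ * (k₀ * (β * Q * X)) := by
    calc _ ≤ ∑ j ∈ Finset.range (n + 1), (if n < j + k₀ then k₀ * (β * Q * X) else 0) := by
          refine Finset.sum_le_sum fun j hj => ?_
          split_ifs
          · exact inner
          · simp
      _ ≤ _ := by
          rw [← Finset.sum_filter, Finset.sum_const, nsmul_eq_mul]
          gcongr
          calc _ ≤ (Finset.Ico (n + 1 - k₀) (n + 1)).card := Finset.card_le_card (fun i hi => by
                  simp only [Finset.mem_filter, Finset.mem_Ico, Finset.mem_range] at *; omega)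
            _ ≤ k₀ := by rw [Nat.card_Ico]; omega
  have hc : dbl p M c n ≤ X := by
    rw [dbl_c c p φ hc0 hrec M n hn]
    have : 0 ≤ φ * (p M * ∑ k ∈ Finset.range (n + 1), p k) :=
      mul_nonneg hφ.le (mul_nonneg (hp M).le (Finset.sum_nonneg fun i _ => (hp i).le))
    rw [hX]; linarith
  calc _ ≤ α * X + k₀ * (k₀ * (β * Q * X)) := by
        have := mul_le_mul_of_nonneg_left hc hα0.le
        linarith
    _ = _ := by ring

/-- Existence of the fugacity. -/
theorem exists_phi (c : ℕ → ℝ) (hcpos : ∀ n : ℕ, 0 < n → 0 < c n) (M : ℕ) (ρ : ℝ) (hρ : 0 < ρ)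
    (hM : ρ < M) : ∃ φ : ℝ, 0 < φ ∧
      ∑ k ∈ Finset.range (M + 1), φ ^ k / cfact c k * ((k : ℝ) - ρ) = 0 := by
  have cp := cfact_pos c hcpos
  set G : ℝ → ℝ := fun t => ∑ k ∈ Finset.range (M + 1), t ^ k / cfact c k * ((k : ℝ) - ρ) with hG
  have hcont : Continuous G := by
    rw [hG]; fun_prop
  have hM0 : 0 < M := by
    have : (0:ℝ) < M := hρ.trans hM
    exact_mod_cast this
  have h0 : G 0 < 0 := by
    simp only [hG]
    rw [Finset.sum_range_succ']
    simp [cfact, hρ]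
  set A := ((M : ℝ) - ρ) / cfact c M
  have hA : 0 < A := div_pos (by linarith) (cp M)
  set B := ∑ k ∈ Finset.range M, ρ / cfact c k
  have hB : 0 ≤ B := Finset.sum_nonneg fun k _ => div_nonneg hρ.le (cp k).le
  set t := B / A + 1
  have ht : 1 ≤ t := by have : 0 ≤ B / A := by positivity
                        linarith
  have h1 : 0 < G t := by
    simp only [hG]
    rw [Finset.sum_range_succ]
    have e1 : -(t ^ (M - 1) * B) ≤ ∑ k ∈ Finset.range M, t ^ k / cfact c k * ((k : ℝ) - ρ) := by
      rw [← mul_neg, ← Finset.sum_neg_distrib, Finset.mul_sum]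
      refine Finset.sum_le_sum fun k hk => ?_
      have hk' : k ≤ M - 1 := by simp at hk; omega
      have e2 : t ^ k ≤ t ^ (M - 1) := pow_le_pow_right₀ ht hk'
      have e3 : 0 ≤ t ^ k / cfact c k * (k : ℝ) :=
        mul_nonneg (div_nonneg (by positivity) (cp k).le) (by positivity)
      have e4 : t ^ k * (ρ / cfact c k) ≤ t ^ (M - 1) * (ρ / cfact c k) :=
        mul_le_mul_of_nonneg_right e2 (div_nonneg hρ.le (cp k).le)
      have e5 : t ^ k / cfact c k * ((k : ℝ) - ρ) = t ^ k / cfact c k * (k : ℝ) - t ^ k * (ρ / cfact c k) := by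
        ring
      rw [e5]; linarith
    have e6 : t ^ M / cfact c M * ((M : ℝ) - ρ) = t ^ (M - 1) * (t * A) := by
      have : t ^ M = t ^ (M - 1) * t := by rw [← pow_succ]; congr 1; omega
      rw [this]; simp only [A]; ring
    have e7 : t * A = B + A := by simp only [t]; field_simp
    rw [e6, e7]
    have : 0 < t ^ (M - 1) := by positivity
    nlinarith
  have : (0:ℝ) ∈ Set.Icc (G 0) (G t) := ⟨h0.le, h1.le⟩
  obtain ⟨φ, hφ, hφ0⟩ := intermediate_value_Icc (by linarith : (0:ℝ) ≤ t) hcont.continuousOn this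
  refine ⟨φ, lt_of_le_of_ne hφ.1 ?_, hφ0⟩
  rintro rfl
  linarith


theorem h_diff (c : ℕ → ℝ) (a a₁ : ℝ) (hc0 : c 0 = 0) (ha : 0 < a)
    (hlow : ∀ n : ℕ, a * n ≤ c n) (hLG : ∀ k : ℕ, |c (k + 1) - c k| ≤ a₁)
    (j k : ℕ) (hjk : j ≤ k) :
    |hfun c k - hfun c j| ≤ 2 * a₁ / a ^ 2 * (((k : ℝ) - j) / (k + 1)) := by
  obtain ⟨d, rfl⟩ := Nat.exists_eq_add_of_le hjk
  have ha₁ : 0 ≤ a₁ := (abs_nonneg _).trans (hLG 0)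
  have l1 := hlow (j + 1)
  have l2 := hlow (j + d + 1)
  have u1 := (abs_le.mp (c_le c a₁ hLG 0 (j + 1))).2
  have e1 := c_le c a₁ hLG (j + 1) d
  rw [show j + 1 + d = j + d + 1 by ring] at e1
  rw [hc0, zero_add, sub_zero] at u1
  unfold hfun
  push_cast at *
  set x := c (j + 1)
  set y := c (j + d + 1)
  have hj1 : (0:ℝ) < j + 1 := by positivity
  have hk1 : (0:ℝ) < (j:ℝ) + d + 1 := by positivity
  have hx : 0 < x := lt_of_lt_of_le (by positivity) l1
  have hy : 0 < y := lt_of_lt_of_le (by positivity) l2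
  have e : ((j:ℝ) + d + 1) / y - (j + 1) / x = (d * x - (j + 1) * (y - x)) / (x * y) := by
    field_simp; ring
  rw [e, abs_div, abs_of_pos (mul_pos hx hy), div_le_iff₀ (mul_pos hx hy)]
  have n1 : |d * x - (j + 1) * (y - x)| ≤ 2 * a₁ * d * (j + 1) := by
    calc _ ≤ |d * x| + |(j + 1) * (y - x)| := abs_sub _ _
      _ = d * x + (j + 1) * |y - x| := by
          rw [abs_mul, abs_mul, abs_of_pos hx, abs_of_pos hj1, abs_of_nonneg (by positivity : (0:ℝ) ≤ d)]
      _ ≤ d * (a₁ * (j + 1)) + (j + 1) * (a₁ * d) := by gcongr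
      _ = _ := by ring
  refine n1.trans ?_
  have n2 : a * (j + 1) * (a * (j + d + 1)) ≤ x * y := by gcongr
  calc 2 * a₁ * d * (j + 1)
      = 2 * a₁ / a ^ 2 * ((j + d - j) / (j + d + 1)) * (a * (j + 1) * (a * (j + d + 1))) := by
        field_simp; ring
    _ ≤ _ := by
        apply mul_le_mul_of_nonneg_left n2
        apply mul_nonneg (by positivity)
        apply div_nonneg _ hk1.le
        have : (0:ℝ) ≤ d := by positivity
        linarith

set_option maxHeartbeats 4000000 in
theorem stein_pkg (c : ℕ → ℝ) (a₁ a₂ : ℝ) (k₀ : ℕ)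
    (hc0 : c 0 = 0) (hcpos : ∀ n : ℕ, 0 < n → 0 < c n)
    (hLG : ∀ k : ℕ, |c (k + 1) - c k| ≤ a₁)
    (hk₀ : 0 < k₀) (ha₂ : 0 < a₂)
    (hM : ∀ j k : ℕ, j + k₀ ≤ k → a₂ ≤ c k - c j) :
    ∃ C : ℝ, 0 < C ∧ ∀ (N : ℕ) (ρ : ℝ), 1 ≤ N → 0 < ρ → ρ ≤ N →
      ∃ (φ m : ℝ) (v u : ℕ → ℝ),
        (∀ n ≤ N, c n * v (n - 1) - φ * v n = n - ρ) ∧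
        (∀ n ≤ N, 1 / (2 * a₁) ≤ v n ∧ v n ≤ C) ∧
        (∀ n ≤ N, c n * u (n - 1) - φ * u n = hfun c n - m) ∧
        (∀ n ≤ N, |u n| ≤ C / ρ) := by
  obtain ⟨a, ha, hlow⟩ := c_lower c a₂ k₀ hc0 hcpos hk₀ ha₂ hM
  have hup : ∀ n : ℕ, c n ≤ a₁ * n := fun n => by
    have := c_le c a₁ hLG 0 n
    rw [hc0, zero_add, sub_zero] at this
    exact (abs_le.mp this).2
  have haa : a ≤ a₁ := by
    have := (hlow 1).trans (hup 1); simpa using this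
  have ha₁ : 0 < a₁ := lt_of_lt_of_le ha haa
  obtain ⟨C, hC, hCup⟩ := dbl_id_upper c a a₁ a₂ k₀ hc0 ha haa hcpos hlow hLG hk₀ ha₂ hM
  have cp := cfact_pos c hcpos
  set C₂ := 4 * a₁ ^ 2 / a ^ 2 * C + 2 / a with hC₂
  have hC₂0 : 0 < C₂ := by positivity
  refine ⟨C + C₂ / a, by positivity, fun N ρ hN hρ hρN => ?_⟩
  have hN' : (1:ℝ) ≤ N := by exact_mod_cast hN
  -- choice of M
  set B := 2 * a₁ * N + 1 with hB
  have hB1 : 1 ≤ B := by have : 0 ≤ 2 * a₁ * N := by positivity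
                         linarith
  set K := ∑ n ∈ Finset.range (N + 1), cfact c n with hK
  have hK0 : 0 < K := Finset.sum_pos (fun i _ => cp i) (by simp)
  obtain ⟨M, hM2, hMK⟩ : ∃ M : ℕ, 2 * N ≤ M ∧ B ^ M * K ≤ cfact c M / 2 := by
    have t := FloorSemiring.tendsto_pow_div_factorial_atTop (B / a)
    have t2 := (t.eventually (gt_mem_nhds (show (0:ℝ) < 1 / (2 * K) by positivity))).and
      (Filter.eventually_ge_atTop (2 * N))
    obtain ⟨M, h1, h2⟩ := t2.exists
    refine ⟨M, h2, ?_⟩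
    have cl : ∀ n : ℕ, a ^ n * (n.factorial : ℝ) ≤ cfact c n := by
      intro n
      induction n with
      | zero => simp [cfact]
      | succ n ih =>
        rw [Nat.factorial_succ]
        simp only [cfact]
        have := hlow (n + 1)
        calc a ^ (n + 1) * (((n + 1) * n.factorial : ℕ) : ℝ)
            = (a ^ n * n.factorial) * (a * ((n + 1 : ℕ) : ℝ)) := by push_cast; ring
          _ ≤ _ := mul_le_mul ih this (by positivity) (cp n).le
    have hf : (0:ℝ) < M.factorial := by exact_mod_cast M.factorial_pos
    rw [div_pow, div_div, div_lt_div_iff₀ (by positivity) (by positivity)] at h1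
    have := cl M
    linarith
  obtain ⟨φ, hφ, hmean⟩ := exists_phi c hcpos M ρ hρ (by
    have : ((2 * N : ℕ) : ℝ) ≤ M := by exact_mod_cast hM2
    push_cast at this; linarith)
  have hM2' : 2 * (N : ℝ) ≤ M := by exact_mod_cast hM2
  set p : ℕ → ℝ := fun n => φ ^ n / cfact c n with hp_def
  have hp : ∀ n, 0 < p n := fun n => div_pos (by positivity) (cp n)
  have hrec : ∀ n, p (n + 1) * c (n + 1) = φ * p n := by
    intro n
    simp only [hp_def, cfact]
    have := cp n
    have := hcpos (n + 1) (by omega)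
    field_simp
    ring
  have hmean' : ∑ k ∈ Finset.range (M + 1), p k * ((fun k : ℕ => (k : ℝ)) k - ρ) = 0 := hmean
  set Z := ∑ k ∈ Finset.range (M + 1), p k with hZ
  have hZ0 : 0 < Z := Finset.sum_pos (fun i _ => hp i) (by simp)
  have hmean2 : ∑ k ∈ Finset.range (M + 1), p k * (k : ℝ) = ρ * Z := by
    have : ∑ k ∈ Finset.range (M + 1), p k * ((k : ℝ) - ρ)
      = ∑ k ∈ Finset.range (M + 1), p k * (k : ℝ) - ρ * Z := by
      rw [hZ, Finset.mul_sum, ← Finset.sum_sub_distrib]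
      exact Finset.sum_congr rfl fun k _ => by ring
    have h2 : ∑ k ∈ Finset.range (M + 1), p k * ((k : ℝ) - ρ) = 0 := hmean
    linarith
  have hcsum : ∑ k ∈ Finset.range (M + 1), p k * c k = φ * (Z - p M) := by
    rw [Finset.sum_range_succ', hc0, hZ, Finset.sum_range_succ]
    simp only [hrec]
    rw [← Finset.mul_sum]; ring
  have hphi_lo : a * ρ ≤ φ := by
    have : a * (ρ * Z) ≤ φ * (Z - p M) := by
      rw [← hcsum, ← hmean2, Finset.mul_sum]
      refine Finset.sum_le_sum fun k _ => ?_
      have := mul_le_mul_of_nonneg_left (hlow k) (hp k).le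
      linarith
    have h2 : a * ρ * Z ≤ φ * Z := by nlinarith [mul_pos hφ (hp M)]
    exact le_of_mul_le_mul_right h2 hZ0
  have hpM : p M ≤ Z / 2 := by
    have : p M * (M : ℝ) ≤ ρ * Z := by
      rw [← hmean2]
      exact Finset.single_le_sum (f := fun k => p k * (k : ℝ))
        (fun i _ => mul_nonneg (hp i).le (by positivity)) (by simp)
    have h3 : p M * (2 * N) ≤ N * Z := by
      calc p M * (2 * N) ≤ p M * M := by have := (hp M).le; gcongr
        _ ≤ ρ * Z := this
        _ ≤ N * Z := by gcongr
    nlinarith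
  have hphi_up : φ ≤ B := by
    have : φ * (Z - p M) ≤ a₁ * (ρ * Z) := by
      rw [← hcsum, ← hmean2, Finset.mul_sum]
      refine Finset.sum_le_sum fun k _ => ?_
      have := mul_le_mul_of_nonneg_left (hup k) (hp k).le
      linarith
    have h2 : φ * (Z / 2) ≤ a₁ * (N * Z) := by
      calc φ * (Z / 2) ≤ φ * (Z - p M) := by gcongr; linarith
        _ ≤ _ := this
        _ ≤ _ := by gcongr
    have h3 : φ * Z ≤ (2 * a₁ * N) * Z := by linarith
    have := le_of_mul_le_mul_right h3 hZ0
    linarith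
  have hpMn : ∀ n ≤ N, p M ≤ p n / 2 := by
    intro n hn
    have k1 : cfact c n ≤ K := Finset.single_le_sum (f := cfact c) (fun i _ => (cp i).le) (by simp; omega)
    have h1 : φ ^ (M - n) ≤ B ^ M :=
      (pow_le_pow_left₀ hφ.le hphi_up _).trans (pow_le_pow_right₀ hB1 (by omega))
    have h2 : φ ^ M = φ ^ (M - n) * φ ^ n := by rw [← pow_add]; congr 1; omega
    have cM := cp M
    have cn := cp n
    simp only [hp_def]
    rw [h2, div_div, div_le_div_iff₀ cM (by positivity)]
    have h4 : φ ^ (M - n) * cfact c n ≤ cfact c M / 2 :=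
      (mul_le_mul h1 k1 cn.le (by positivity)).trans hMK
    have : 0 < φ ^ n := by positivity
    nlinarith
  -- the mean of h
  set m := (∑ k ∈ Finset.range (M + 1), p k * hfun c k) / Z with hm
  have hm0 : ∑ k ∈ Finset.range (M + 1), p k * (hfun c k - m) = 0 := by
    have : ∑ k ∈ Finset.range (M + 1), p k * (hfun c k - m)
      = ∑ k ∈ Finset.range (M + 1), p k * hfun c k - m * Z := by
      rw [hZ, Finset.mul_sum, ← Finset.sum_sub_distrib]
      exact Finset.sum_congr rfl fun k _ => by ring
    rw [this, hm]; field_simp; ring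
  have hv_up : ∀ n ≤ N, tl p M ρ (fun k : ℕ => (k : ℝ)) n ≤ C * (φ * p n) := by
    intro n hn
    have h1 := hCup p φ hφ hp hrec M n (by omega)
    rw [dbl_eq p M ρ _ n (by omega) hmean'] at h1
    have : Z * tl p M ρ (fun k : ℕ => (k : ℝ)) n ≤ Z * (C * (φ * p n)) := by
      rw [← hZ] at h1; linarith
    exact le_of_mul_le_mul_left this hZ0
  refine ⟨φ, m, fun n => tl p M ρ (fun k : ℕ => (k : ℝ)) n / (φ * p n),
    fun n => tl p M m (hfun c) n / (φ * p n), ?_, ?_, ?_, ?_⟩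
  · intro n hn
    exact stein_eq c p φ hφ hc0 hp hrec M ρ (fun k : ℕ => (k : ℝ)) hmean' n (by omega)
  · intro n hn
    have hpn := hp n
    have hX : 0 < φ * p n := by positivity
    constructor
    · rw [le_div_iff₀ hX]
      have h1 : dbl p M c n ≤ dbl p M (fun k => a₁ * (fun k : ℕ => (k : ℝ)) k) n := by
        apply dbl_mono p hp
        intro j k hj hk
        obtain ⟨d, rfl⟩ := Nat.exists_eq_add_of_lt (show j < k by omega)
        have := (abs_le.mp (c_le c a₁ hLG j (d + 1))).2
        rw [← add_assoc] at this
        push_cast at *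
        linarith
      rw [dbl_smul, dbl_eq p M ρ _ n (by omega) hmean', dbl_c c p φ hc0 hrec M n (by omega),
        ← hZ] at h1
      have h2 : ∑ k ∈ Finset.range (n + 1), p k ≤ Z := by
        rw [hZ, sum_split_range p n M (by omega)]
        have : 0 ≤ ∑ k ∈ Finset.Ioc n M, p k := Finset.sum_nonneg fun i _ => (hp i).le
        linarith
      have h3 : p M * ∑ k ∈ Finset.range (n + 1), p k ≤ p n / 2 * Z :=
        mul_le_mul (hpMn n hn) h2 (Finset.sum_nonneg fun i _ => (hp i).le) (by positivity)
      have h4 : Z * (φ * p n / 2) ≤ Z * (a₁ * tl p M ρ (fun k : ℕ => (k : ℝ)) n) := by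
        have h5 := mul_le_mul_of_nonneg_left h3 hφ.le
        nlinarith
      have h6 := le_of_mul_le_mul_left h4 hZ0
      rw [div_mul_eq_mul_div, div_le_iff₀ (by positivity)]
      linarith
    · rw [div_le_iff₀ hX]
      have := hv_up n hn
      have : 0 ≤ C₂ / a * (φ * p n) := by positivity
      linarith
  · intro n hn
    exact stein_eq c p φ hφ hc0 hp hrec M m (hfun c) hm0 n (by omega)
  · intro n hn
    have hpn := hp n
    have hX : 0 < φ * p n := by positivity
    have main : |tl p M m (hfun c) n| ≤ C₂ * p n := by
      rcases le_total (2 * a₁ * n) φ with h | h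
      · -- direct bound
        have hh : ∀ k, 0 ≤ hfun c k ∧ hfun c k ≤ 1 / a := by
          intro k
          have l := hlow (k + 1)
          have := hcpos (k + 1) (by omega)
          unfold hfun
          refine ⟨by positivity, ?_⟩
          rw [div_le_div_iff₀ this ha]
          push_cast at l; linarith
        have hm1 : 0 ≤ m := div_nonneg (Finset.sum_nonneg fun k _ => mul_nonneg (hp k).le (hh k).1) hZ0.le
        have hm2 : m ≤ 1 / a := by
          rw [hm, div_le_iff₀ hZ0, hZ, Finset.mul_sum]
          refine Finset.sum_le_sum fun k _ => ?_
          have := mul_le_mul_of_nonneg_left (hh k).2 (hp k).le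
          linarith
        have e : tl p M m (hfun c) n = - ∑ k ∈ Finset.range (n + 1), p k * (hfun c k - m) := by
          rw [sum_split_range _ n M (by omega)] at hm0
          unfold tl; linarith
        rw [e, abs_neg]
        calc _ ≤ ∑ k ∈ Finset.range (n + 1), |p k * (hfun c k - m)| := Finset.abs_sum_le_sum_abs _ _
          _ ≤ ∑ k ∈ Finset.range (n + 1), ((1 / 2 : ℝ) ^ (n - k) * p n) * (1 / a) := by
              refine Finset.sum_le_sum fun k hk => ?_
              have hkn : k ≤ n := by simp at hk; omega
              rw [abs_mul, abs_of_pos (hp k)]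
              have q1 : |hfun c k - m| ≤ 1 / a := by
                rw [abs_le]; have := hh k; constructor <;> linarith
              have q2 : p k ≤ (1 / 2 : ℝ) ^ (n - k) * p n := by
                have := p_down c p φ (1 / 2) hφ hp hrec (by norm_num) k (n - k) (fun i hi => by
                  have hi' : (i : ℝ) ≤ n := by exact_mod_cast (by omega : i ≤ n)
                  have := hup i
                  have := mul_le_mul_of_nonneg_left hi' ha₁.le
                  linarith)
                rwa [show k + (n - k) = n by omega] at this
              exact mul_le_mul q2 q1 (abs_nonneg _) (by positivity)
          _ = (∑ k ∈ Finset.range (n + 1), (1 / 2 : ℝ) ^ (n - k)) * (p n * (1 / a)) := by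
              rw [Finset.sum_mul]; exact Finset.sum_congr rfl fun k _ => by ring
          _ ≤ 2 * (p n * (1 / a)) := by
              gcongr
              have := Finset.sum_range_reflect (fun k => (1 / 2 : ℝ) ^ k) (n + 1)
              simp only [Nat.add_sub_cancel] at this
              rw [this]
              exact sum_geometric_two_le _
          _ = 2 / a * p n := by ring
          _ ≤ _ := by
              have : 0 ≤ 4 * a₁ ^ 2 / a ^ 2 * C := by positivity
              rw [hC₂]; gcongr; linarith
      · set ℓ := 4 * a₁ ^ 2 / a ^ 2 / φ with hℓ
        have hℓ0 : 0 < ℓ := by positivity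
        have hd : ∀ j k : ℕ, j ≤ n → n < k → |hfun c k - hfun c j| ≤ ℓ * ((k : ℝ) - j) := by
          intro j k hj hk
          refine (h_diff c a a₁ hc0 ha hlow hLG j k (by omega)).trans ?_
          have hkj : (0:ℝ) ≤ (k:ℝ) - j := by
            have : (j:ℝ) ≤ k := by exact_mod_cast (by omega : j ≤ k)
            linarith
          have hkn : (n:ℝ) ≤ k := by exact_mod_cast (by omega : n ≤ k)
          have : φ ≤ 2 * a₁ * ((k : ℝ) + 1) := by nlinarith
          have h7 : 1 / ((k : ℝ) + 1) ≤ 2 * a₁ / φ := by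
            rw [div_le_div_iff₀ (by positivity) hφ]; linarith
          calc 2 * a₁ / a ^ 2 * (((k:ℝ) - j) / (k + 1))
              = 2 * a₁ / a ^ 2 * ((k:ℝ) - j) * (1 / (k + 1)) := by ring
            _ ≤ 2 * a₁ / a ^ 2 * ((k:ℝ) - j) * (2 * a₁ / φ) := by gcongr
            _ = _ := by rw [hℓ]; ring
        have h1 : dbl p M (hfun c) n ≤ dbl p M (fun k => ℓ * (fun k : ℕ => (k : ℝ)) k) n := by
          apply dbl_mono p hp
          intro j k hj hk
          have := (abs_le.mp (hd j k hj hk)).2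
          simp only; linarith
        have h2 : dbl p M (fun k => (-ℓ) * (fun k : ℕ => (k : ℝ)) k) n ≤ dbl p M (hfun c) n := by
          apply dbl_mono p hp
          intro j k hj hk
          have := (abs_le.mp (hd j k hj hk)).1
          simp only; linarith
        rw [dbl_smul, dbl_eq p M ρ _ n (by omega) hmean', dbl_eq p M m _ n (by omega) hm0, ← hZ] at h1 h2
        have h3 : tl p M m (hfun c) n ≤ ℓ * tl p M ρ (fun k : ℕ => (k : ℝ)) n :=
          le_of_mul_le_mul_left (by linarith) hZ0
        have h4 : -(ℓ * tl p M ρ (fun k : ℕ => (k : ℝ)) n) ≤ tl p M m (hfun c) n :=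
          le_of_mul_le_mul_left (by linarith) hZ0
        have h5 : ℓ * tl p M ρ (fun k : ℕ => (k : ℝ)) n ≤ C₂ * p n := by
          calc _ ≤ ℓ * (C * (φ * p n)) := by gcongr; exact hv_up n hn
            _ = 4 * a₁ ^ 2 / a ^ 2 * C * p n := by rw [hℓ]; field_simp
            _ ≤ _ := by
              have : 0 ≤ 2 / a := by positivity
              rw [hC₂]; gcongr; linarith
        rw [abs_le]; constructor <;> linarith
    rw [abs_div, abs_of_pos hX, div_le_iff₀ hX]
    calc _ ≤ C₂ * p n := main
      _ = C₂ / a / ρ * (a * ρ * p n) := by field_simp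
      _ ≤ C₂ / a / ρ * (φ * p n) := by gcongr
      _ ≤ (C + C₂ / a) / ρ * (φ * p n) := by gcongr; linarith


/-- the product weight -/
def Wt (c : ℕ → ℝ) (Λ : Finset ℤ) (η : ℤ → ℕ) : ℝ := ∏ x ∈ Λ, (cfact c (η x))⁻¹

/-- add a particle at `x` -/
def up (ζ : ℤ → ℕ) (x : ℤ) : ℤ → ℕ := Function.update ζ x (ζ x + 1)

/-- unnormalised expectation -/
def Ex (c : ℕ → ℝ) (Λ : Finset ℤ) (N : ℕ) (F : (ℤ → ℕ) → ℝ) : ℝ :=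
  ∑ η ∈ Finset.piAntidiag Λ N, Wt c Λ η * F η

theorem up_same (ζ : ℤ → ℕ) (x : ℤ) : up ζ x x = ζ x + 1 := by simp [up]

theorem up_ne (ζ : ℤ → ℕ) (x z : ℤ) (h : z ≠ x) : up ζ x z = ζ z := by simp [up, h]

theorem Wt_pos (c : ℕ → ℝ) (hcpos : ∀ n : ℕ, 0 < n → 0 < c n) (Λ : Finset ℤ) (η : ℤ → ℕ) :
    0 < Wt c Λ η := Finset.prod_pos fun _ _ => inv_pos.mpr (cfact_pos c hcpos _)

theorem Ex_add (c : ℕ → ℝ) (Λ : Finset ℤ) (N : ℕ) (F G : (ℤ → ℕ) → ℝ) :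
    Ex c Λ N (fun η => F η + G η) = Ex c Λ N F + Ex c Λ N G := by
  unfold Ex; rw [← Finset.sum_add_distrib]; exact Finset.sum_congr rfl fun _ _ => by ring

theorem Ex_sub (c : ℕ → ℝ) (Λ : Finset ℤ) (N : ℕ) (F G : (ℤ → ℕ) → ℝ) :
    Ex c Λ N (fun η => F η - G η) = Ex c Λ N F - Ex c Λ N G := by
  unfold Ex; rw [← Finset.sum_sub_distrib]; exact Finset.sum_congr rfl fun _ _ => by ring

theorem Ex_smul (c : ℕ → ℝ) (Λ : Finset ℤ) (N : ℕ) (a : ℝ) (F : (ℤ → ℕ) → ℝ) :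
    Ex c Λ N (fun η => a * F η) = a * Ex c Λ N F := by
  unfold Ex; rw [Finset.mul_sum]; exact Finset.sum_congr rfl fun _ _ => by ring

theorem Ex_sum {ι : Type*} (c : ℕ → ℝ) (Λ : Finset ℤ) (N : ℕ) (s : Finset ι)
    (F : ι → (ℤ → ℕ) → ℝ) :
    Ex c Λ N (fun η => ∑ i ∈ s, F i η) = ∑ i ∈ s, Ex c Λ N (F i) := by
  unfold Ex; simp_rw [Finset.mul_sum]; exact Finset.sum_comm

theorem Ex_congr (c : ℕ → ℝ) (Λ : Finset ℤ) (N : ℕ) (F G : (ℤ → ℕ) → ℝ)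
    (h : ∀ η ∈ Finset.piAntidiag Λ N, F η = G η) : Ex c Λ N F = Ex c Λ N G :=
  Finset.sum_congr rfl fun η hη => by rw [h η hη]

theorem Ex_mono (c : ℕ → ℝ) (hcpos : ∀ n : ℕ, 0 < n → 0 < c n) (Λ : Finset ℤ) (N : ℕ)
    (F G : (ℤ → ℕ) → ℝ)
    (h : ∀ η ∈ Finset.piAntidiag Λ N, F η ≤ G η) : Ex c Λ N F ≤ Ex c Λ N G :=
  Finset.sum_le_sum fun η hη => mul_le_mul_of_nonneg_left (h η hη) (Wt_pos c hcpos Λ η).le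

theorem Ex_abs (c : ℕ → ℝ) (hcpos : ∀ n : ℕ, 0 < n → 0 < c n) (Λ : Finset ℤ) (N : ℕ)
    (F : (ℤ → ℕ) → ℝ) : |Ex c Λ N F| ≤ Ex c Λ N (fun η => |F η|) := by
  unfold Ex
  refine (Finset.abs_sum_le_sum_abs _ _).trans (le_of_eq ?_)
  refine Finset.sum_congr rfl fun η _ => ?_
  rw [abs_mul, abs_of_pos (Wt_pos c hcpos Λ η)]

theorem Ex_nonneg (c : ℕ → ℝ) (hcpos : ∀ n : ℕ, 0 < n → 0 < c n) (Λ : Finset ℤ) (N : ℕ)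
    (F : (ℤ → ℕ) → ℝ) (h : ∀ η, 0 ≤ F η) : 0 ≤ Ex c Λ N F :=
  Finset.sum_nonneg fun η _ => mul_nonneg (Wt_pos c hcpos Λ η).le (h η)

theorem Ex_shift (c : ℕ → ℝ) (hc0 : c 0 = 0) (hcpos : ∀ n : ℕ, 0 < n → 0 < c n)
    (Λ : Finset ℤ) (n : ℕ) (x : ℤ) (hx : x ∈ Λ) (G : (ℤ → ℕ) → ℝ) :
    Ex c Λ (n + 1) (fun η => c (η x) * G η) = Ex c Λ n (fun ζ => G (up ζ x)) := by
  unfold Ex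
  symm
  have hsum : ∀ ζ : ℤ → ℕ, ∑ z ∈ Λ, up ζ x z = ∑ z ∈ Λ, ζ z + 1 := by
    intro ζ
    rw [← Finset.add_sum_erase _ _ hx, ← Finset.add_sum_erase (a := x) Λ ζ hx, up_same]
    rw [Finset.sum_congr rfl (fun z hz => up_ne ζ x z (Finset.ne_of_mem_erase hz))]
    ring
  rw [← Finset.sum_filter_of_ne (s := Finset.piAntidiag Λ (n + 1)) (p := fun η => η x ≠ 0)]
  · refine Finset.sum_bij' (fun ζ _ => up ζ x) (fun η _ => Function.update η x (η x - 1)) ?_ ?_ ?_ ?_ ?_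
    · intro ζ hζ
      simp only [Finset.mem_filter, Finset.mem_piAntidiag] at hζ ⊢
      refine ⟨⟨by rw [hsum, hζ.1], fun i hi => ?_⟩, by rw [up_same]; omega⟩
      by_cases h : i = x
      · rw [h]; exact hx
      · rw [up_ne _ _ _ h] at hi; exact hζ.2 i hi
    · intro η hη
      simp only [Finset.mem_filter, Finset.mem_piAntidiag] at hη ⊢
      have e : up (Function.update η x (η x - 1)) x = η := by
        funext z
        by_cases h : z = x
        · subst h; rw [up_same]; simp; omega
        · rw [up_ne _ _ _ h]; simp [h]
      have := hsum (Function.update η x (η x - 1))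
      rw [e, hη.1.1] at this
      refine ⟨(Nat.add_right_cancel this).symm, fun i hi => ?_⟩
      by_cases h : i = x
      · rw [h]; exact hx
      · simp only [Function.update_of_ne h] at hi; exact hη.1.2 i hi
    · intro ζ hζ
      funext z
      by_cases h : z = x
      · subst h; simp [up_same]
      · simp [h, up_ne]
    · intro η hη
      simp only [Finset.mem_filter] at hη
      funext z
      by_cases h : z = x
      · subst h; rw [up_same]; simp; omega
      · rw [up_ne _ _ _ h]; simp [h]
    · intro ζ hζ
      have e : Wt c Λ (up ζ x) * c (up ζ x x) = Wt c Λ ζ := by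
        unfold Wt
        rw [← Finset.mul_prod_erase _ _ hx, ← Finset.mul_prod_erase Λ (fun z => (cfact c (ζ z))⁻¹) hx, up_same]
        rw [Finset.prod_congr rfl (fun z hz => by rw [up_ne ζ x z (Finset.ne_of_mem_erase hz)])]
        simp only [cfact]
        have h1 := cfact_pos c hcpos (ζ x)
        have h2 := hcpos (ζ x + 1) (by omega)
        field_simp
      rw [← mul_assoc, e]
  · intro η _ h h0
    apply h
    show Wt c Λ η * (c (η x) * G η) = 0
    rw [h0, hc0]; ring

theorem mem_le (Λ : Finset ℤ) (N : ℕ) (η : ℤ → ℕ) (h : η ∈ Finset.piAntidiag Λ N) (x : ℤ)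
    (hx : x ∈ Λ) : η x ≤ N := by
  rw [Finset.mem_piAntidiag] at h
  rw [← h.1]
  exact Finset.single_le_sum (f := η) (fun _ _ => Nat.zero_le _) hx

theorem pair_id (c : ℕ → ℝ) (hc0 : c 0 = 0) (hcpos : ∀ n : ℕ, 0 < n → 0 < c n)
    (Λ : Finset ℤ) (n : ℕ) (x y : ℤ) (hx : x ∈ Λ) (hy : y ∈ Λ) (hxy : x ≠ y)
    (F : (ℤ → ℕ) → ℝ) (u : ℕ → ℝ) :
    Ex c Λ (n + 1) (fun η => F η * (c (η x) * u (η x - 1) - c (η y) * u (η x)))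
      = Ex c Λ n (fun ζ => u (ζ x) * (F (up ζ x) - F (up ζ y))) := by
  have h1 := Ex_shift c hc0 hcpos Λ n x hx (fun η => F η * u (η x - 1))
  have h2 := Ex_shift c hc0 hcpos Λ n y hy (fun η => F η * u (η x))
  rw [Ex_congr _ _ _ _ (fun η => c (η x) * (F η * u (η x - 1)) - c (η y) * (F η * u (η x)))
    (fun η _ => by ring), Ex_sub, h1, h2, ← Ex_sub]
  refine Ex_congr _ _ _ _ _ fun ζ _ => ?_
  rw [up_same, up_ne ζ y x hxy, Nat.add_sub_cancel]
  ring

/-- the `L¹` Dirichlet functional -/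
def KK (c : ℕ → ℝ) (Λ : Finset ℤ) (n : ℕ) (F : (ℤ → ℕ) → ℝ) : ℝ :=
  ∑ x ∈ Λ, ∑ y ∈ Λ, Ex c Λ n (fun ζ => |F (up ζ x) - F (up ζ y)|)

/-- clamp to `[-1,1]` -/
def clamp (t : ℝ) : ℝ := max (-1) (min 1 t)

theorem clamp_abs (t : ℝ) : |clamp t| ≤ 1 := by
  unfold clamp; rw [abs_le]; constructor
  · exact le_max_left _ _
  · exact max_le (by norm_num) (min_le_left _ _)

theorem clamp_lip (s t : ℝ) : |clamp s - clamp t| ≤ |s - t| := by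
  unfold clamp
  calc _ ≤ |min 1 s - min 1 t| := by
        have := abs_max_sub_max_le_max (-1) (min 1 s) (-1) (min 1 t)
        simpa using this
    _ ≤ |s - t| := by
        have := abs_min_sub_min_le_max 1 s 1 t
        simpa using this

theorem clamp_mul (t : ℝ) : |t| ≤ 1 + clamp t * t ∧ 0 ≤ clamp t * t := by
  unfold clamp
  rcases le_total t (-1) with h | h
  · rw [min_eq_right (by linarith), max_eq_left h, abs_of_neg (by linarith)]
    constructor <;> linarith
  · rcases le_total t 1 with h2 | h2
    · rw [min_eq_right h2, max_eq_right h]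
      refine ⟨?_, by nlinarith⟩
      rw [abs_le]; constructor <;> nlinarith
    · rw [min_eq_left h2, max_eq_right (by norm_num), abs_of_pos (by linarith)]
      constructor <;> linarith

theorem mul_diff (f f' s s' θ : ℝ) (hf : 0 ≤ f) (hf' : 0 ≤ f') (hs : |s| ≤ 1) (hs' : |s'| ≤ 1)
    (h : |s - s'| ≤ θ) : |f * s - f' * s'| ≤ |f - f'| + θ / 2 * (f + f') := by
  have e : f * s - f' * s' = (f - f') * ((s + s') / 2) + (f + f') / 2 * (s - s') := by ring
  rw [e]
  refine (abs_add_le _ _).trans ?_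
  rw [abs_mul, abs_mul, abs_of_nonneg (by positivity : 0 ≤ (f + f') / 2)]
  have h1 : |(s + s') / 2| ≤ 1 := by
    rw [abs_le] at *; constructor <;> linarith
  have h2 := mul_le_mul_of_nonneg_left h1 (abs_nonneg (f - f'))
  have h3 := mul_le_mul_of_nonneg_left h (by positivity : 0 ≤ (f + f') / 2)
  linarith

theorem Ex_ff (c : ℕ → ℝ) (hc0 : c 0 = 0) (hcpos : ∀ n : ℕ, 0 < n → 0 < c n)
    (Λ : Finset ℤ) (n : ℕ) (f : (ℤ → ℕ) → ℝ) (x y : ℤ) (hx : x ∈ Λ) (hy : y ∈ Λ) :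
    Ex c Λ n (fun ζ => f (up ζ x) + f (up ζ y)) =
      Ex c Λ (n + 1) (fun η => c (η x) * f η) + Ex c Λ (n + 1) (fun η => c (η y) * f η) := by
  rw [Ex_add, Ex_shift c hc0 hcpos Λ n x hx, Ex_shift c hc0 hcpos Λ n y hy]

theorem sum_c_le (c : ℕ → ℝ) (a₁ : ℝ) (hc0 : c 0 = 0) (hcpos : ∀ n : ℕ, 0 < n → 0 < c n)
    (hLG : ∀ k : ℕ, |c (k + 1) - c k| ≤ a₁) (Λ : Finset ℤ) (n : ℕ)
    (f : (ℤ → ℕ) → ℝ) (hf : ∀ η, 0 ≤ f η) : ∑ x ∈ Λ, Ex c Λ (n + 1) (fun η => c (η x) * f η)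
    ≤ a₁ * ((n + 1 : ℕ) : ℝ) * Ex c Λ (n + 1) f := by
  rw [← Ex_sum, ← Ex_smul]
  refine Ex_mono c hcpos _ _ _ _ fun η hη => ?_
  rw [← Finset.sum_mul]
  refine mul_le_mul_of_nonneg_right ?_ (hf η)
  rw [Finset.mem_piAntidiag] at hη
  rw [← hη.1]
  push_cast
  rw [Finset.mul_sum]
  refine Finset.sum_le_sum fun x _ => ?_
  have := c_le c a₁ hLG 0 (η x)
  rw [hc0, zero_add, sub_zero] at this
  exact (abs_le.mp this).2

theorem sum_ff_le (c : ℕ → ℝ) (a₁ : ℝ) (hc0 : c 0 = 0) (hcpos : ∀ n : ℕ, 0 < n → 0 < c n)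
    (hLG : ∀ k : ℕ, |c (k + 1) - c k| ≤ a₁) (Λ : Finset ℤ) (n : ℕ)
    (f : (ℤ → ℕ) → ℝ) (hf : ∀ η, 0 ≤ f η) : ∑ x ∈ Λ, ∑ y ∈ Λ, Ex c Λ n (fun ζ => f (up ζ x) + f (up ζ y))
    ≤ 2 * Λ.card * (a₁ * ((n + 1 : ℕ) : ℝ) * Ex c Λ (n + 1) f) := by
  have h := sum_c_le c a₁ hc0 hcpos hLG Λ n f hf
  rw [Finset.sum_congr rfl fun x hx => Finset.sum_congr rfl fun y hy =>
    Ex_ff c hc0 hcpos Λ n f x y hx hy]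
  simp only [Finset.sum_add_distrib, Finset.sum_const, nsmul_eq_mul, ← Finset.mul_sum]
  have := mul_le_mul_of_nonneg_left h (Nat.cast_nonneg (α := ℝ) Λ.card)
  linarith

theorem KK_mul (c : ℕ → ℝ) (a₁ : ℝ) (hc0 : c 0 = 0) (hcpos : ∀ n : ℕ, 0 < n → 0 < c n)
    (hLG : ∀ k : ℕ, |c (k + 1) - c k| ≤ a₁) (Λ : Finset ℤ) (n : ℕ)
    (f : (ℤ → ℕ) → ℝ) (hf : ∀ η, 0 ≤ f η) 
    (s : (ℤ → ℕ) → ℝ) (θ : ℝ) (hθ : 0 ≤ θ) (hs : ∀ η, |s η| ≤ 1)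
    (hd : ∀ ζ, ∀ x ∈ Λ, ∀ y ∈ Λ, |s (up ζ x) - s (up ζ y)| ≤ θ) :
    KK c Λ n (fun η => f η * s η) ≤ KK c Λ n f +
      θ * Λ.card * (a₁ * ((n + 1 : ℕ) : ℝ) * Ex c Λ (n + 1) f) := by
  have h := sum_ff_le c a₁ hc0 hcpos hLG Λ n f hf
  have : KK c Λ n (fun η => f η * s η) ≤ KK c Λ n f +
      θ / 2 * ∑ x ∈ Λ, ∑ y ∈ Λ, Ex c Λ n (fun ζ => f (up ζ x) + f (up ζ y)) := by
    unfold KK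
    simp only [Finset.mul_sum, ← Finset.sum_add_distrib]
    refine Finset.sum_le_sum fun x hx => Finset.sum_le_sum fun y hy => ?_
    rw [← Ex_smul, ← Ex_add]
    refine Ex_mono c hcpos _ _ _ _ fun ζ _ => ?_
    exact mul_diff _ _ _ _ _ (hf _) (hf _) (hs _) (hs _) (hd ζ x hx y hy)
  have h2 := mul_le_mul_of_nonneg_left h (by linarith : 0 ≤ θ / 2)
  linarith

/-- Bound on `∑ |c_x - c_y|`. -/
theorem BB_le (c : ℕ → ℝ) (a₁ : ℝ) (hc0 : c 0 = 0) (hcpos : ∀ n : ℕ, 0 < n → 0 < c n)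
    (hLG : ∀ k : ℕ, |c (k + 1) - c k| ≤ a₁) (Λ : Finset ℤ) (n : ℕ)
    (f : (ℤ → ℕ) → ℝ) (hf : ∀ η, 0 ≤ f η) 
    (hΛ : 1 ≤ Λ.card) :
    ∑ x ∈ Λ, ∑ y ∈ Λ, Ex c Λ (n + 1) (fun η => f η * |c (η x) - c (η y)|)
    ≤ (1 + 2 * a₁ ^ 2) * Λ.card ^ 2 * (√((n + 1 : ℕ) : ℝ) * Ex c Λ (n + 1) f) + KK c Λ n f := by
  set q := √((n + 1 : ℕ) : ℝ) with hq
  have hN : (0:ℝ) < ((n + 1 : ℕ) : ℝ) := by positivity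
  have hq0 : 0 < q := Real.sqrt_pos.mpr hN
  have hqq : q * q = ((n + 1 : ℕ) : ℝ) := Real.mul_self_sqrt hN.le
  have ha₁ : 0 ≤ a₁ := (abs_nonneg _).trans (hLG 0)
  have hE : 0 ≤ Ex c Λ (n + 1) f := Ex_nonneg c hcpos _ _ _ hf
  have hpair : ∀ x ∈ Λ, ∀ y ∈ Λ, Ex c Λ (n + 1) (fun η => f η * |c (η x) - c (η y)|) ≤
      q * Ex c Λ (n + 1) f + (Ex c Λ n (fun ζ => |f (up ζ x) - f (up ζ y)|) +
        a₁ / q * Ex c Λ n (fun ζ => f (up ζ x) + f (up ζ y))) := by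
    intro x hx y hy
    set s : (ℤ → ℕ) → ℝ := fun η => clamp ((c (η x) - c (η y)) / q) with hs
    have e1 : Ex c Λ (n + 1) (fun η => f η * |c (η x) - c (η y)|) ≤
        q * Ex c Λ (n + 1) f + Ex c Λ (n + 1) (fun η => (c (η x) * (f η * s η) - c (η y) * (f η * s η))) := by
      rw [← Ex_smul, ← Ex_add]
      refine Ex_mono c hcpos _ _ _ _ fun η _ => ?_
      have h1 := (clamp_mul ((c (η x) - c (η y)) / q)).1
      have h2 : |c (η x) - c (η y)| ≤ q + s η * (c (η x) - c (η y)) := by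
        rw [abs_div, abs_of_pos hq0, div_le_iff₀ hq0] at h1
        calc _ ≤ _ := h1
          _ = q + s η * (c (η x) - c (η y)) := by simp only [hs]; field_simp
      have := mul_le_mul_of_nonneg_left h2 (hf η)
      linarith
    refine e1.trans ?_
    rw [Ex_sub, Ex_shift c hc0 hcpos Λ n x hx (fun η => f η * s η),
      Ex_shift c hc0 hcpos Λ n y hy (fun η => f η * s η), ← Ex_sub, ← Ex_smul (a := a₁ / q),
      ← Ex_add (F := fun ζ => |f (up ζ x) - f (up ζ y)|)]
    gcongr
    refine Ex_mono c hcpos _ _ _ _ fun ζ _ => ?_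
    refine (le_abs_self _).trans ?_
    have hd : |s (up ζ x) - s (up ζ y)| ≤ 2 * (a₁ / q) := by
      by_cases hxy : x = y
      · subst hxy; simp; positivity
      · refine (clamp_lip _ _).trans ?_
        rw [up_same, up_same, up_ne _ _ _ hxy, up_ne _ _ _ (Ne.symm hxy), ← sub_div, abs_div,
          abs_of_pos hq0, ← mul_div_assoc]
        gcongr
        have i1 := abs_le.mp (hLG (ζ x))
        have i2 := abs_le.mp (hLG (ζ y))
        rw [abs_le]; constructor <;> linarith
    have := mul_diff (f (up ζ x)) (f (up ζ y)) (s (up ζ x)) (s (up ζ y)) _ (hf _) (hf _)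
      (clamp_abs _) (clamp_abs _) hd
    linarith
  have hsum := Finset.sum_le_sum fun x hx => Finset.sum_le_sum fun y hy => hpair x hx y hy
  refine hsum.trans ?_
  simp only [Finset.sum_add_distrib, Finset.sum_const, nsmul_eq_mul]
  have e3 : ∑ x ∈ Λ, ∑ y ∈ Λ, a₁ / q * Ex c Λ n (fun ζ => f (up ζ x) + f (up ζ y))
      ≤ 2 * a₁ ^ 2 * Λ.card ^ 2 * (q * Ex c Λ (n + 1) f) := by
    simp only [← Finset.mul_sum]
    have h := sum_ff_le c a₁ hc0 hcpos hLG Λ n f hf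
    have hL : (1:ℝ) ≤ Λ.card := by exact_mod_cast hΛ
    calc _ ≤ a₁ / q * (2 * Λ.card * (a₁ * ((n + 1 : ℕ) : ℝ) * Ex c Λ (n + 1) f)) := by gcongr
      _ = 2 * a₁ ^ 2 * Λ.card * (q * Ex c Λ (n + 1) f) := by rw [← hqq]; field_simp
      _ ≤ 2 * a₁ ^ 2 * Λ.card ^ 2 * (q * Ex c Λ (n + 1) f) := by
          gcongr; nlinarith
  unfold KK
  nlinarith

theorem sum_id (c : ℕ → ℝ) (hc0 : c 0 = 0) (hcpos : ∀ n : ℕ, 0 < n → 0 < c n)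
    (Λ : Finset ℤ) (n : ℕ) (F : (ℤ → ℕ) → ℝ) (φ m B : ℝ) (g w : ℕ → ℝ) 
    (hst : ∀ k ≤ n + 1, c k * w (k - 1) - φ * w k = g k - m) (hw : ∀ k ≤ n + 1, |w k| ≤ B) :
    |Ex c Λ (n + 1) (fun η => F η * ((Λ.card - 1) * (∑ x ∈ Λ, (g (η x) - m)) +
      ∑ x ∈ Λ, w (η x) * (∑ y ∈ Λ, (φ - c (η y)) - (φ - c (η x)))))| ≤ B * KK c Λ n F := by
  have hB : 0 ≤ B := (abs_nonneg _).trans (hw 0 (by omega))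
  have e : Ex c Λ (n + 1) (fun η => F η * ((Λ.card - 1) * (∑ x ∈ Λ, (g (η x) - m)) +
      ∑ x ∈ Λ, w (η x) * (∑ y ∈ Λ, (φ - c (η y)) - (φ - c (η x))))) =
      ∑ x ∈ Λ, ∑ y ∈ Λ.erase x, Ex c Λ n (fun ζ => w (ζ x) * (F (up ζ x) - F (up ζ y))) := by
    rw [Finset.sum_congr rfl fun x hx => Finset.sum_congr rfl fun y hy =>
      (pair_id c hc0 hcpos Λ n x y hx (Finset.mem_of_mem_erase hy)
        (Finset.ne_of_mem_erase hy).symm F w).symm]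
    simp only [← Ex_sum]
    refine Ex_congr _ _ _ _ _ fun η hη => ?_
    simp only [← Finset.mul_sum]
    congr 1
    rw [Finset.mul_sum, ← Finset.sum_add_distrib]
    refine Finset.sum_congr rfl fun x hx => ?_
    have h1 := hst (η x) (mem_le Λ _ η hη x hx)
    have h2 : ∑ y ∈ Λ.erase x, (c (η x) * w (η x - 1) - c (η y) * w (η x)) =
        ∑ y ∈ Λ.erase x, ((g (η x) - m) + w (η x) * (φ - c (η y))) :=
      Finset.sum_congr rfl fun y _ => by linarith
    rw [h2, Finset.sum_add_distrib, ← Finset.mul_sum, Finset.sum_const, nsmul_eq_mul,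
      Finset.card_erase_of_mem hx, Nat.cast_sub (Finset.card_pos.mpr ⟨x, hx⟩),
      Finset.sum_erase_eq_sub hx]
    push_cast
    ring
  rw [e]
  unfold KK
  rw [Finset.mul_sum]
  refine (Finset.abs_sum_le_sum_abs _ _).trans (Finset.sum_le_sum fun x hx => ?_)
  refine (Finset.abs_sum_le_sum_abs _ _).trans ?_
  rw [Finset.mul_sum]
  refine (Finset.sum_le_sum_of_subset_of_nonneg (Finset.erase_subset x Λ)
    fun _ _ _ => abs_nonneg _).trans (Finset.sum_le_sum fun y _ => ?_)
  refine (Ex_abs c hcpos _ _ _).trans ?_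
  rw [← Ex_smul]
  refine Ex_mono c hcpos _ _ _ _ fun ζ hζ => ?_
  rw [abs_mul]
  exact mul_le_mul_of_nonneg_right (hw _ ((mem_le Λ n ζ hζ x hx).trans (by omega))) (abs_nonneg _)

theorem pt_id (Λ : Finset ℤ) (d : ℤ → ℝ) (x : ℤ) :
    (Λ.card : ℝ) * (∑ y ∈ Λ, d y - d x) = (Λ.card - 1) * ∑ y ∈ Λ, d y + ∑ y ∈ Λ, (d y - d x) := by
  rw [Finset.sum_sub_distrib, Finset.sum_const, nsmul_eq_mul]; ring

theorem pt_low (Λ : Finset ℤ) (hΛ : 1 ≤ Λ.card) (d v : ℤ → ℝ) (lo C s : ℝ) (hlo : 0 ≤ lo)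
    (hv : ∀ x ∈ Λ, lo ≤ v x ∧ v x ≤ C) (hs : |s| ≤ 1) (hG : 0 ≤ s * ∑ y ∈ Λ, d y) :
    lo * (Λ.card * (Λ.card - 1)) * (s * ∑ y ∈ Λ, d y) ≤
      Λ.card * (s * ∑ x ∈ Λ, v x * (∑ y ∈ Λ, d y - d x)) +
        C * ∑ x ∈ Λ, ∑ y ∈ Λ, |d x - d y| := by
  have hL : (1:ℝ) ≤ Λ.card := by exact_mod_cast hΛ
  have e : Λ.card * (s * ∑ x ∈ Λ, v x * (∑ y ∈ Λ, d y - d x)) =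
      ∑ x ∈ Λ, v x * ((Λ.card - 1) * (s * ∑ y ∈ Λ, d y) + s * ∑ y ∈ Λ, (d y - d x)) := by
    rw [Finset.mul_sum, Finset.mul_sum]
    refine Finset.sum_congr rfl fun x _ => ?_
    have := pt_id Λ d x
    linear_combination (s * v x) * this
  rw [e, Finset.mul_sum Λ (fun x => ∑ y ∈ Λ, |d x - d y|) C, ← Finset.sum_add_distrib]
  have e2 : lo * (Λ.card * (Λ.card - 1)) * (s * ∑ y ∈ Λ, d y) =
      ∑ x ∈ Λ, lo * ((Λ.card - 1) * (s * ∑ y ∈ Λ, d y)) := by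
    rw [Finset.sum_const, nsmul_eq_mul]; ring
  rw [e2]
  refine Finset.sum_le_sum fun x hx => ?_
  obtain ⟨h1, h2⟩ := hv x hx
  have h3 : 0 ≤ (Λ.card - 1) * (s * ∑ y ∈ Λ, d y) := mul_nonneg (by linarith) hG
  have h4 : |s * ∑ y ∈ Λ, (d y - d x)| ≤ ∑ y ∈ Λ, |d x - d y| := by
    rw [abs_mul]
    calc _ ≤ 1 * |∑ y ∈ Λ, (d y - d x)| := by gcongr
      _ ≤ ∑ y ∈ Λ, |d y - d x| := by rw [one_mul]; exact Finset.abs_sum_le_sum_abs _ _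
      _ = _ := Finset.sum_congr rfl fun y _ => abs_sub_comm _ _
  have h5 : 0 ≤ ∑ y ∈ Λ, |d x - d y| := Finset.sum_nonneg fun _ _ => abs_nonneg _
  have h6 := (abs_le.mp h4).1
  have h7 : 0 ≤ v x := hlo.trans h1
  nlinarith [mul_le_mul_of_nonneg_right h1 h3, mul_le_mul_of_nonneg_right h2 h5,
    mul_le_mul_of_nonneg_left h6 h7]

theorem pt_up (Λ : Finset ℤ) (hΛ : 1 ≤ Λ.card) (d u : ℤ → ℝ) (B : ℝ) (hB : 0 ≤ B)
    (hu : ∀ x ∈ Λ, |u x| ≤ B) :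
    Λ.card * |∑ x ∈ Λ, u x * (∑ y ∈ Λ, d y - d x)| ≤
      B * (Λ.card * (Λ.card * |∑ y ∈ Λ, d y|) + ∑ x ∈ Λ, ∑ y ∈ Λ, |d x - d y|) := by
  have hL : (1:ℝ) ≤ Λ.card := by exact_mod_cast hΛ
  have e0 : B * (Λ.card * (Λ.card * |∑ y ∈ Λ, d y|) + ∑ x ∈ Λ, ∑ y ∈ Λ, |d x - d y|) =
      ∑ x ∈ Λ, B * (Λ.card * |∑ y ∈ Λ, d y| + ∑ y ∈ Λ, |d x - d y|) := by
    rw [← Finset.mul_sum, Finset.sum_add_distrib, Finset.sum_const, nsmul_eq_mul]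
  rw [e0]
  have e1 : Λ.card * |∑ x ∈ Λ, u x * (∑ y ∈ Λ, d y - d x)| =
      |∑ x ∈ Λ, u x * (Λ.card * (∑ y ∈ Λ, d y - d x))| := by
    rw [← abs_of_nonneg (by linarith : (0:ℝ) ≤ Λ.card), ← abs_mul, Finset.mul_sum,
      abs_of_nonneg (by linarith : (0:ℝ) ≤ Λ.card)]
    congr 1
    exact Finset.sum_congr rfl fun x _ => by ring
  rw [e1]
  refine (Finset.abs_sum_le_sum_abs _ _).trans (Finset.sum_le_sum fun x hx => ?_)
  rw [abs_mul]
  refine mul_le_mul (hu x hx) ?_ (abs_nonneg _) hB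
  rw [pt_id]
  refine (abs_add_le _ _).trans (add_le_add ?_ ?_)
  · rw [abs_mul, abs_of_nonneg (by linarith : (0:ℝ) ≤ Λ.card - 1)]
    gcongr; linarith
  · refine (Finset.abs_sum_le_sum_abs _ _).trans (le_of_eq ?_)
    exact Finset.sum_congr rfl fun y _ => abs_sub_comm _ _

theorem G_diff (c : ℕ → ℝ) (a₁ : ℝ) (hLG : ∀ k : ℕ, |c (k + 1) - c k| ≤ a₁) (Λ : Finset ℤ)
    (φ : ℝ) (ζ : ℤ → ℕ) (x y : ℤ) (hx : x ∈ Λ) (hy : y ∈ Λ) :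
    |∑ z ∈ Λ, (φ - c (up ζ x z)) - ∑ z ∈ Λ, (φ - c (up ζ y z))| ≤ 2 * a₁ := by
  have key : ∀ x ∈ Λ, ∑ z ∈ Λ, (φ - c (up ζ x z)) =
      ∑ z ∈ Λ, (φ - c (ζ z)) - (c (ζ x + 1) - c (ζ x)) := by
    intro x hx
    rw [← Finset.add_sum_erase _ _ hx, ← Finset.add_sum_erase (a := x) Λ (fun z => φ - c (ζ z)) hx,
      up_same, Finset.sum_congr rfl (fun z hz => by rw [up_ne ζ x z (Finset.ne_of_mem_erase hz)])]
    ring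
  rw [key x hx, key y hy]
  have i1 := abs_le.mp (hLG (ζ x))
  have i2 := abs_le.mp (hLG (ζ y))
  rw [abs_le]; constructor <;> linarith

theorem A_lemma (c : ℕ → ℝ) (a₁ : ℝ) (hc0 : c 0 = 0) (hcpos : ∀ n : ℕ, 0 < n → 0 < c n)
    (hLG : ∀ k : ℕ, |c (k + 1) - c k| ≤ a₁) (Λ : Finset ℤ) (n : ℕ)
    (f : (ℤ → ℕ) → ℝ) (hf : ∀ η, 0 ≤ f η) (hΛ : 2 ≤ Λ.card) (C φ : ℝ) (v : ℕ → ℝ)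
    (h1 : ∀ k ≤ n + 1, c k * v (k - 1) - φ * v k = (k : ℝ) - ((n + 1 : ℕ) : ℝ) / Λ.card)
    (h2 : ∀ k ≤ n + 1, 1 / (2 * a₁) ≤ v k ∧ v k ≤ C) :
    Λ.card * Ex c Λ (n + 1) (fun η => f η * |∑ y ∈ Λ, (φ - c (η y))|) ≤
      (1 + 4 * a₁ * C * (3 + 4 * a₁ ^ 2)) * (KK c Λ n f +
        Λ.card * (√((n + 1 : ℕ) : ℝ) * Ex c Λ (n + 1) f)) := by
  set q := √((n + 1 : ℕ) : ℝ) with hq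
  have hN : (0:ℝ) < ((n + 1 : ℕ) : ℝ) := by positivity
  have hq0 : 0 < q := Real.sqrt_pos.mpr hN
  have hqq : q * q = ((n + 1 : ℕ) : ℝ) := Real.mul_self_sqrt hN.le
  have ha₁ : 0 < a₁ := by
    have i1 := hLG 0
    have i2 := hcpos 1 one_pos
    rw [hc0, sub_zero, zero_add] at i1
    exact i2.trans_le ((le_abs_self _).trans i1)
  have hE : 0 ≤ Ex c Λ (n + 1) f := Ex_nonneg c hcpos _ _ _ hf
  have hK : 0 ≤ KK c Λ n f := Finset.sum_nonneg fun x _ => Finset.sum_nonneg fun y _ =>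
    Ex_nonneg c hcpos _ _ _ fun _ => abs_nonneg _
  have hL : (2:ℝ) ≤ Λ.card := by exact_mod_cast hΛ
  have hlo : 0 ≤ 1 / (2 * a₁) := by positivity
  have hC : 0 < C := lt_of_lt_of_le (by positivity) ((h2 0 (by omega)).1.trans (h2 0 (by omega)).2)
  set G : (ℤ → ℕ) → ℝ := fun η => ∑ y ∈ Λ, (φ - c (η y)) with hG
  set s : (ℤ → ℕ) → ℝ := fun η => clamp (G η / q) with hs
  have hsG : ∀ η, |G η| ≤ q + s η * G η ∧ 0 ≤ s η * G η := by
    intro η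
    obtain ⟨i1, i2⟩ := clamp_mul (G η / q)
    have e : s η * G η = q * (clamp (G η / q) * (G η / q)) := by simp only [hs]; field_simp
    rw [e]
    refine ⟨?_, by positivity⟩
    rw [abs_div, abs_of_pos hq0, div_le_iff₀ hq0] at i1
    linarith
  have hKs := KK_mul c a₁ hc0 hcpos hLG Λ n f hf s (2 * a₁ / q) (by positivity)
    (fun η => clamp_abs _) (fun ζ x hx y hy => by
      refine (clamp_lip _ _).trans ?_
      rw [← sub_div, abs_div, abs_of_pos hq0]
      gcongr
      exact G_diff c a₁ hLG Λ φ ζ x y hx hy)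
  have e1 : 2 * a₁ / q * Λ.card * (a₁ * ((n + 1 : ℕ) : ℝ) * Ex c Λ (n + 1) f) =
      2 * a₁ ^ 2 * (Λ.card * (q * Ex c Λ (n + 1) f)) := by rw [← hqq]; field_simp
  rw [e1] at hKs
  have hvabs : ∀ k ≤ n + 1, |v k| ≤ C := fun k hk => by
    rw [abs_of_nonneg (hlo.trans (h2 k hk).1)]; exact (h2 k hk).2
  have hid := sum_id c hc0 hcpos Λ n (fun η => f η * s η) φ (((n + 1 : ℕ) : ℝ) / Λ.card) C
    (fun k => (k : ℝ)) v h1 hvabs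
  set T : (ℤ → ℕ) → ℝ := fun η => ∑ x ∈ Λ, v (η x) * (G η - (φ - c (η x))) with hT
  have e2 : Ex c Λ (n + 1) (fun η => f η * s η * ((Λ.card - 1) *
      (∑ x ∈ Λ, ((η x : ℝ) - ((n + 1 : ℕ) : ℝ) / Λ.card)) +
      ∑ x ∈ Λ, v (η x) * (∑ y ∈ Λ, (φ - c (η y)) - (φ - c (η x))))) =
      Ex c Λ (n + 1) (fun η => f η * (s η * T η)) := by
    refine Ex_congr _ _ _ _ _ fun η hη => ?_
    have : (∑ x ∈ Λ, ((η x : ℝ) - ((n + 1 : ℕ) : ℝ) / Λ.card)) = 0 := by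
      rw [Finset.mem_piAntidiag] at hη
      rw [Finset.sum_sub_distrib, Finset.sum_const, nsmul_eq_mul, mul_div_cancel₀ _ (by linarith),
        ← hη.1]
      push_cast; ring
    rw [this]; simp only [hT, hG]; ring
  rw [e2] at hid
  have hST := (abs_le.mp hid).2
  set BB := ∑ x ∈ Λ, ∑ y ∈ Λ, Ex c Λ (n + 1) (fun η => f η * |c (η x) - c (η y)|) with hBB
  have hB : BB ≤ _ := BB_le c a₁ hc0 hcpos hLG Λ n f hf (by omega)
  set X := Ex c Λ (n + 1) (fun η => f η * (s η * G η)) with hX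
  have hXlow : 1 / (2 * a₁) * (Λ.card * (Λ.card - 1)) * X ≤
      Λ.card * Ex c Λ (n + 1) (fun η => f η * (s η * T η)) + C * BB := by
    rw [hBB, hX]
    simp only [← Ex_sum]
    rw [← Ex_smul, ← Ex_smul, ← Ex_smul, ← Ex_add]
    refine Ex_mono c hcpos _ _ _ _ fun η hη => ?_
    have := pt_low Λ (by omega) (fun y => φ - c (η y)) (fun y => v (η y)) (1 / (2 * a₁)) C (s η)
      hlo (fun x hx => h2 _ (mem_le Λ _ η hη x hx)) (clamp_abs _) (hsG η).2
    have h := mul_le_mul_of_nonneg_left this (hf η)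
    have e3 : ∑ x ∈ Λ, ∑ y ∈ Λ, f η * |c (η x) - c (η y)| =
        f η * ∑ x ∈ Λ, ∑ y ∈ Λ, |(φ - c (η x)) - (φ - c (η y))| := by
      simp only [Finset.mul_sum]
      refine Finset.sum_congr rfl fun x _ => Finset.sum_congr rfl fun y _ => ?_
      rw [abs_sub_comm]; congr 2; ring
    rw [e3]
    simp only [hT, hG]
    linarith
  have hGX : Ex c Λ (n + 1) (fun η => f η * |G η|) ≤ q * Ex c Λ (n + 1) f + X := by
    rw [hX, ← Ex_smul, ← Ex_add]
    refine Ex_mono c hcpos _ _ _ _ fun η _ => ?_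
    have := mul_le_mul_of_nonneg_left (hsG η).1 (hf η)
    linarith
  have hX0 : 0 ≤ X := Ex_nonneg c hcpos _ _ _ fun η => mul_nonneg (hf η) (hsG η).2
  generalize Ex c Λ (n + 1) (fun η => f η * |G η|) = Y at *
  generalize Ex c Λ (n + 1) (fun η => f η * (s η * T η)) = Z at *
  generalize KK c Λ n (fun η => f η * s η) = Ks at *
  generalize KK c Λ n f = K at *
  set E := Ex c Λ (n + 1) f
  set L : ℝ := (Λ.card : ℝ)
  have hR : 0 ≤ q * E := by positivity
  generalize q * E = R at *
  have k1 : Z ≤ C * (K + 2 * a₁ ^ 2 * (L * R)) := hST.trans (by gcongr)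
  have k2 : 1 / (2 * a₁) * (L * (L / 2)) * X ≤
      L * (C * (K + 2 * a₁ ^ 2 * (L * R))) + C * ((1 + 2 * a₁ ^ 2) * L ^ 2 * R + K) := by
    refine le_trans ?_ (hXlow.trans (by gcongr))
    have : L / 2 ≤ L - 1 := by linarith
    gcongr
  have k3 : L * (C * (K + 2 * a₁ ^ 2 * (L * R))) + C * ((1 + 2 * a₁ ^ 2) * L ^ 2 * R + K) ≤
      L * (C * (3 + 4 * a₁ ^ 2) * (K + L * R)) := by
    have i1 : 0 ≤ C * K := by positivity
    have i2 : 0 ≤ C * K * L * (1 + 4 * a₁ ^ 2) := by positivity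
    have i3 : 0 ≤ C * L ^ 2 * R := by positivity
    nlinarith [mul_le_mul_of_nonneg_right hL i1]
  have k4 : L * X ≤ 4 * a₁ * (C * (3 + 4 * a₁ ^ 2) * (K + L * R)) := by
    have i : L * (L * X) ≤ L * (4 * a₁ * (C * (3 + 4 * a₁ ^ 2) * (K + L * R))) := by
      have := mul_le_mul_of_nonneg_left (k2.trans k3) (by positivity : 0 ≤ 4 * a₁)
      have e : 4 * a₁ * (1 / (2 * a₁) * (L * (L / 2)) * X) = L * (L * X) := by field_simp; ring
      rw [e] at this
      linarith
    exact le_of_mul_le_mul_left i (by linarith)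
  have k5 : L * Y ≤ L * (R + X) := by gcongr
  nlinarith

theorem h_lemma (c : ℕ → ℝ) (a₁ a₂ : ℝ) (k₀ : ℕ)
    (hc0 : c 0 = 0) (hcpos : ∀ n : ℕ, 0 < n → 0 < c n)
    (hLG : ∀ k : ℕ, |c (k + 1) - c k| ≤ a₁)
    (hk₀ : 0 < k₀) (ha₂ : 0 < a₂)
    (hM : ∀ j k : ℕ, j + k₀ ≤ k → a₂ ≤ c k - c j) :
    ∃ C : ℝ, 0 < C ∧ ∀ (Λ : Finset ℤ) (n : ℕ), 2 ≤ Λ.card → ∃ m : ℝ, 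
      ∀ f : (ℤ → ℕ) → ℝ, (∀ η, 0 ≤ f η) →
      |Ex c Λ (n + 1) (fun η => f η * ∑ x ∈ Λ, (hfun c (η x) - m))| ≤
        C / ((n + 1 : ℕ) : ℝ) * (KK c Λ n f +
        Λ.card * (√((n + 1 : ℕ) : ℝ) * Ex c Λ (n + 1) f)) := by
  obtain ⟨C, hC, H⟩ := stein_pkg c a₁ a₂ k₀ hc0 hcpos hLG hk₀ ha₂ hM
  have ha₁ : 0 < a₁ := by
    have i1 := hLG 0
    have i2 := hcpos 1 one_pos
    rw [hc0, sub_zero, zero_add] at i1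
    exact i2.trans_le ((le_abs_self _).trans i1)
  set A := 1 + 4 * a₁ * C * (3 + 4 * a₁ ^ 2) with hA
  have hA0 : 0 < A := by positivity
  refine ⟨2 * C * (3 + A + 2 * a₁ ^ 2), by positivity, fun Λ n hΛ => ?_⟩
  have hL : (2:ℝ) ≤ Λ.card := by exact_mod_cast hΛ
  have hN : (0:ℝ) < ((n + 1 : ℕ) : ℝ) := by positivity
  obtain ⟨φ, m, v, u, h1, h2, h3, h4⟩ := H (n + 1) (((n + 1 : ℕ) : ℝ) / Λ.card) (by omega)
    (by positivity) (div_le_self hN.le (by linarith))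
  refine ⟨m, fun f hf => ?_⟩
  have hAl := A_lemma c a₁ hc0 hcpos hLG Λ n f hf hΛ C φ v h1 h2
  rw [← hA] at hAl
  have hB := BB_le c a₁ hc0 hcpos hLG Λ n f hf (by omega)
  have hid := sum_id c hc0 hcpos Λ n f φ m _ _ _ h3 h4
  set B := C / (((n + 1 : ℕ) : ℝ) / Λ.card) with hBd
  have hB0 : 0 < B := by positivity
  set BB := ∑ x ∈ Λ, ∑ y ∈ Λ, Ex c Λ (n + 1) (fun η => f η * |c (η x) - c (η y)|) with hBB
  have hR : 0 ≤ √((n + 1 : ℕ) : ℝ) * Ex c Λ (n + 1) f :=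
    mul_nonneg (Real.sqrt_nonneg _) (Ex_nonneg c hcpos _ _ _ hf)
  have hK : 0 ≤ KK c Λ n f := Finset.sum_nonneg fun x _ => Finset.sum_nonneg fun y _ =>
    Ex_nonneg c hcpos _ _ _ fun _ => abs_nonneg _
  set X := Ex c Λ (n + 1) (fun η => f η * ∑ x ∈ Λ, (hfun c (η x) - m)) with hX
  set T := Ex c Λ (n + 1) (fun η => f η * 
    ∑ x ∈ Λ, u (η x) * (∑ y ∈ Λ, (φ - c (η y)) - (φ - c (η x)))) with hT
  have e1 : Ex c Λ (n + 1) (fun η => f η * ((Λ.card - 1) * (∑ x ∈ Λ, (hfun c (η x) - m)) +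
      ∑ x ∈ Λ, u (η x) * (∑ y ∈ Λ, (φ - c (η y)) - (φ - c (η x))))) =
      (Λ.card - 1) * X + T := by
    rw [hX, hT, ← Ex_smul, ← Ex_add]
    exact Ex_congr _ _ _ _ _ fun η _ => by ring
  rw [e1] at hid
  have hTb : Λ.card * |T| ≤ B * (Λ.card * (Λ.card * 
      Ex c Λ (n + 1) (fun η => f η * |∑ y ∈ Λ, (φ - c (η y))|)) + BB) := by
    refine (mul_le_mul_of_nonneg_left (Ex_abs c hcpos _ _ _) (by linarith)).trans ?_
    rw [hBB]
    simp only [← Ex_sum]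
    rw [← Ex_smul, ← Ex_smul, ← Ex_smul, ← Ex_add, ← Ex_smul]
    refine Ex_mono c hcpos _ _ _ _ fun η hη => ?_
    have := pt_up Λ (by omega) (fun y => φ - c (η y)) (fun y => u (η y)) B hB0.le
      (fun x hx => h4 _ (mem_le Λ _ η hη x hx))
    have h := mul_le_mul_of_nonneg_left this (hf η)
    have e3 : ∑ x ∈ Λ, ∑ y ∈ Λ, f η * |c (η x) - c (η y)| =
        f η * ∑ x ∈ Λ, ∑ y ∈ Λ, |(φ - c (η x)) - (φ - c (η y))| := by
      simp only [Finset.mul_sum]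
      refine Finset.sum_congr rfl fun x _ => Finset.sum_congr rfl fun y _ => ?_
      rw [abs_sub_comm]; congr 2; ring
    rw [e3, abs_mul, abs_of_nonneg (hf η)]
    linarith
  generalize Ex c Λ (n + 1) (fun η => f η * |∑ y ∈ Λ, (φ - c (η y))|) = Y at *
  generalize KK c Λ n f = K at *
  generalize √((n + 1 : ℕ) : ℝ) * Ex c Λ (n + 1) f = R at *
  have e4 : B = C / ((n + 1 : ℕ) : ℝ) * Λ.card := by rw [hBd]; field_simp
  set L : ℝ := (Λ.card : ℝ)
  have k1 : (L - 1) * |X| ≤ B * K + |T| := by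
    have i1 : (L - 1) * |X| = |(L - 1) * X| := by
      rw [abs_mul, abs_of_nonneg (by linarith : 0 ≤ L - 1)]
    have i2 : (L - 1) * X = ((L - 1) * X + T) - T := by ring
    rw [i1, i2]
    exact (abs_sub _ _).trans (by linarith)
  have k2 : L * ((L - 1) * |X|) ≤ L * (B * K) + B * (L * (A * (K + L * R)) +
      ((1 + 2 * a₁ ^ 2) * L ^ 2 * R + K)) := by
    calc _ ≤ L * (B * K + |T|) := by gcongr
      _ = L * (B * K) + L * |T| := by ring
      _ ≤ L * (B * K) + B * (L * (L * Y) + BB) := by gcongr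
      _ ≤ _ := by gcongr
  have k3 : L * (B * K) + B * (L * (A * (K + L * R)) + ((1 + 2 * a₁ ^ 2) * L ^ 2 * R + K)) ≤
      L * (B * ((3 + A + 2 * a₁ ^ 2) * (K + L * R))) := by
    have i1 : 0 ≤ B * K := by positivity
    have i2 : 0 ≤ B * K * L * (1 + 2 * a₁ ^ 2) := by positivity
    have i3 : 0 ≤ B * L ^ 2 * R := by positivity
    nlinarith [mul_le_mul_of_nonneg_right hL i1]
  have k4 : (L - 1) * |X| ≤ B * ((3 + A + 2 * a₁ ^ 2) * (K + L * R)) :=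
    le_of_mul_le_mul_left (k2.trans k3) (by linarith)
  have k5 : L / 2 * |X| ≤ (L - 1) * |X| := by gcongr; linarith
  have k6 := k5.trans k4
  rw [e4] at k6
  have k7 : L * |X| ≤ L * (2 * C * (3 + A + 2 * a₁ ^ 2) / ((n + 1 : ℕ) : ℝ) * (K + L * R)) := by
    have e : L * (2 * C * (3 + A + 2 * a₁ ^ 2) / ((n + 1 : ℕ) : ℝ) * (K + L * R)) =
      2 * (C / ((n + 1 : ℕ) : ℝ) * L * ((3 + A + 2 * a₁ ^ 2) * (K + L * R))) := by ring
    rw [e]; linarith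
  exact le_of_mul_le_mul_left k7 (by linarith)

theorem KK_sq (c : ℕ → ℝ) (a₁ : ℝ) (hc0 : c 0 = 0) (hcpos : ∀ n : ℕ, 0 < n → 0 < c n)
    (hLG : ∀ k : ℕ, |c (k + 1) - c k| ≤ a₁) (Λ : Finset ℤ) (n : ℕ)
    (f : (ℤ → ℕ) → ℝ) (hf : ∀ η, 0 ≤ f η) :
    KK c Λ n f ^ 2 ≤ (∑ x ∈ Λ, ∑ y ∈ Λ, Ex c Λ n (fun ζ => (√(f (up ζ x)) - √(f (up ζ y))) ^ 2)) *
      (4 * Λ.card * (a₁ * ((n + 1 : ℕ) : ℝ) * Ex c Λ (n + 1) f)) := by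
  have h1 := sum_ff_le c a₁ hc0 hcpos hLG Λ n f hf
  have h2 : ∑ x ∈ Λ, ∑ y ∈ Λ, Ex c Λ n (fun ζ => (√(f (up ζ x)) + √(f (up ζ y))) ^ 2) ≤
      4 * Λ.card * (a₁ * ((n + 1 : ℕ) : ℝ) * Ex c Λ (n + 1) f) := by
    have : ∑ x ∈ Λ, ∑ y ∈ Λ, Ex c Λ n (fun ζ => (√(f (up ζ x)) + √(f (up ζ y))) ^ 2) ≤
        2 * ∑ x ∈ Λ, ∑ y ∈ Λ, Ex c Λ n (fun ζ => f (up ζ x) + f (up ζ y)) := by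
      simp only [Finset.mul_sum, ← Ex_smul]
      refine Finset.sum_le_sum fun x _ => Finset.sum_le_sum fun y _ =>
        Ex_mono c hcpos _ _ _ _ fun ζ _ => ?_
      have i1 := Real.sq_sqrt (hf (up ζ x))
      have i2 := Real.sq_sqrt (hf (up ζ y))
      nlinarith [sq_nonneg (√(f (up ζ x)) - √(f (up ζ y)))]
    linarith
  have h3 : 0 ≤ ∑ x ∈ Λ, ∑ y ∈ Λ, Ex c Λ n (fun ζ => (√(f (up ζ x)) - √(f (up ζ y))) ^ 2) :=
    Finset.sum_nonneg fun x _ => Finset.sum_nonneg fun y _ =>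
      Ex_nonneg c hcpos _ _ _ fun _ => sq_nonneg _
  refine le_trans ?_ (mul_le_mul_of_nonneg_left h2 h3)
  unfold KK Ex
  simp only [← Finset.sum_product']
  refine Finset.sum_sq_le_sum_mul_sum_of_sq_le_mul _ ?_ ?_ ?_
  · intro p _; exact mul_nonneg (Wt_pos c hcpos Λ _).le (sq_nonneg _)
  · intro p _; exact mul_nonneg (Wt_pos c hcpos Λ _).le (sq_nonneg _)
  · intro p _
    have i1 := Real.sq_sqrt (hf (up p.2.2 p.1))
    have i2 := Real.sq_sqrt (hf (up p.2.2 p.2.1))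
    refine le_of_eq ?_
    rw [mul_pow, sq_abs]
    nth_rewrite 1 [← i1, ← i2]
    ring

theorem path_sq (b : ℤ → ℝ) (a : ℤ) (L p q : ℕ) (hpq : p ≤ q) (hq : q < L) :
    (b (a + q) - b (a + p)) ^ 2 ≤
      L * ∑ k ∈ Finset.range (L - 1), (b (a + k + 1) - b (a + k)) ^ 2 := by
  have e : b (a + q) - b (a + p) = ∑ k ∈ Finset.Ico p q, (b (a + k + 1) - b (a + k)) := by
    rw [Finset.sum_Ico_eq_sub _ hpq]
    have key : ∀ r : ℕ, ∑ k ∈ Finset.range r, (b (a + k + 1) - b (a + k)) = b (a + r) - b a := by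
      intro r
      induction r with
      | zero => simp
      | succ r ih => rw [Finset.sum_range_succ, ih]; push_cast; rw [← add_assoc]; ring
    rw [key, key]; ring
  rw [e]
  refine sq_sum_le_card_mul_sum_sq.trans ?_
  refine mul_le_mul ?_ ?_ (Finset.sum_nonneg fun _ _ => sq_nonneg _) (by positivity)
  · rw [Nat.card_Ico]; exact_mod_cast (by omega : q - p ≤ L)
  · refine Finset.sum_le_sum_of_subset_of_nonneg ?_ fun _ _ _ => sq_nonneg _
    intro k hk
    rw [Finset.mem_Ico] at hk; rw [Finset.mem_range]; omega

theorem path_sq' (b : ℤ → ℝ) (a : ℤ) (L : ℕ) (x y : ℤ) (hx : x ∈ Finset.Ico a (a + (L : ℤ)))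
    (hy : y ∈ Finset.Ico a (a + (L : ℤ))) :
    (b x - b y) ^ 2 ≤
      L * ∑ k ∈ Finset.range (L - 1), (b (a + k + 1) - b (a + k)) ^ 2 := by
  rw [Finset.mem_Ico] at hx hy
  obtain ⟨p, hp⟩ := Int.eq_ofNat_of_zero_le (by omega : 0 ≤ x - a)
  obtain ⟨q, hq⟩ := Int.eq_ofNat_of_zero_le (by omega : 0 ≤ y - a)
  obtain rfl : x = a + p := by omega
  obtain rfl : y = a + q := by omega
  rcases le_total p q with h | h
  · rw [← neg_sub, neg_sq]; exact path_sq b a L p q h (by omega)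
  · exact path_sq b a L q p h (by omega)

theorem move_up (ζ : ℤ → ℕ) (x y : ℤ) (h : x ≠ y) : move (up ζ x) x y = up ζ y := by
  funext z
  unfold move
  by_cases h1 : z = x
  · subst h1; simp [up_same, up_ne _ _ _ h]
  · by_cases h2 : z = y
    · subst h2; simp [h1, up_same, up_ne _ _ _ h1]
    · simp [h1, h2, up_ne _ _ _ h1, up_ne _ _ _ h2]

theorem D0_le (c : ℕ → ℝ) (hc0 : c 0 = 0) (hcpos : ∀ n : ℕ, 0 < n → 0 < c n)
    (a : ℤ) (L : ℕ) (Λ : Finset ℤ) (hΛ : Λ = Finset.Ico a (a + (L : ℤ))) (n : ℕ)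
    (g : (ℤ → ℕ) → ℝ) :
    ∑ x ∈ Λ, ∑ y ∈ Λ, Ex c Λ n (fun ζ => (g (up ζ x) - g (up ζ y)) ^ 2) ≤
      2 * (L : ℝ) ^ 3 * Ex c Λ (n + 1) (fun η => (1 / 2) * ∑ x ∈ Λ, ∑ y ∈ Λ,
    if |x - y| = 1 then c (η x) * ((g (move η x y) - g η) * (g (move η x y) - g η)) else 0) := by
  set D : ℤ → ℤ → ℝ := fun x y => Ex c Λ n (fun ζ => (g (up ζ y) - g (up ζ x)) ^ 2) with hD
  have hD0 : ∀ x y, 0 ≤ D x y := fun x y => Ex_nonneg c hcpos _ _ _ fun _ => sq_nonneg _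
  have e1 : Ex c Λ (n + 1) (fun η => (1 / 2) * ∑ x ∈ Λ, ∑ y ∈ Λ,
      if |x - y| = 1 then c (η x) * ((g (move η x y) - g η) * (g (move η x y) - g η)) else 0) =
      1 / 2 * ∑ x ∈ Λ, ∑ y ∈ Λ, if |x - y| = 1 then D x y else 0 := by
    rw [Ex_smul, Ex_sum]
    congr 1
    refine Finset.sum_congr rfl fun x hx => ?_
    rw [Ex_sum]
    refine Finset.sum_congr rfl fun y hy => ?_
    by_cases h : |x - y| = 1
    · simp only [h, if_true]
      rw [Ex_shift c hc0 hcpos Λ n x hx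
        (fun η => (g (move η x y) - g η) * (g (move η x y) - g η))]
      have hxy : x ≠ y := by rintro rfl; simp at h
      refine Ex_congr _ _ _ _ _ fun ζ _ => ?_
      simp only [move_up ζ x y hxy]; ring
    · simp only [h, if_false]; simp [Ex]
  rw [e1]
  have e2 : ∑ k ∈ Finset.range (L - 1), D (a + k) (a + k + 1) ≤
      ∑ x ∈ Λ, ∑ y ∈ Λ, if |x - y| = 1 then D x y else 0 := by
    have hinj : Set.InjOn (fun k : ℕ => a + (k : ℤ)) (Finset.range (L - 1)) := by
      intro i _ j _ h; simpa using h
    rw [← Finset.sum_image (g := fun k : ℕ => a + (k : ℤ)) (f := fun x => D x (x + 1)) hinj]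
    have hnn : ∀ x y : ℤ, 0 ≤ (if |x - y| = 1 then D x y else 0) := by
      intro x y; split_ifs; exacts [hD0 x y, le_rfl]
    refine le_trans (Finset.sum_le_sum fun x hx => ?_)
      (Finset.sum_le_sum_of_subset_of_nonneg ?_ fun x _ _ => Finset.sum_nonneg fun y _ => hnn x y)
    · rw [Finset.mem_image] at hx
      obtain ⟨k, hk, rfl⟩ := hx
      rw [Finset.mem_range] at hk
      have := Finset.single_le_sum (f := fun y => if |(a + (k:ℤ)) - y| = 1 then D (a + k) y else 0)
        (s := Λ) (fun y _ => hnn _ y) (a := a + k + 1)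
        (by rw [hΛ, Finset.mem_Ico]; omega)
      simpa using this
    · intro x hx
      rw [Finset.mem_image] at hx
      obtain ⟨k, hk, rfl⟩ := hx
      rw [Finset.mem_range] at hk
      rw [hΛ, Finset.mem_Ico]; omega
  have e3 : ∑ x ∈ Λ, ∑ y ∈ Λ, Ex c Λ n (fun ζ => (g (up ζ x) - g (up ζ y)) ^ 2) ≤
      ∑ x ∈ Λ, ∑ y ∈ Λ, (L : ℝ) * ∑ k ∈ Finset.range (L - 1), D (a + k) (a + k + 1) := by
    refine Finset.sum_le_sum fun x hx => Finset.sum_le_sum fun y hy => ?_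
    rw [hD, ← Ex_sum, ← Ex_smul]
    refine Ex_mono c hcpos _ _ _ _ fun ζ _ => ?_
    exact path_sq' (fun z => g (up ζ z)) a L x y (hΛ ▸ hx) (hΛ ▸ hy)
  refine e3.trans ?_
  have hcard : Λ.card = L := by rw [hΛ, Int.card_Ico]; omega
  simp only [Finset.sum_const, nsmul_eq_mul, hcard]
  have := mul_le_mul_of_nonneg_left e2 (by positivity : 0 ≤ (L:ℝ) ^ 3)
  calc _ = (L:ℝ) ^ 3 * ∑ k ∈ Finset.range (L - 1), D (a + k) (a + k + 1) := by ring
    _ ≤ _ := this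
    _ = _ := by ring

theorem tsum_nu (c : ℕ → ℝ) (Λ : Finset ℤ) (N : ℕ) (F : (ℤ → ℕ) → ℝ) :
    ∑' η : ℤ → ℕ, nuW c Λ N η * F η = Ex c Λ N F := by
  have hmem : ∀ η : ℤ → ℕ, η ∈ Finset.piAntidiag Λ N ↔
      η ∈ {η : ℤ → ℕ | (∀ x, x ∉ Λ → η x = 0) ∧ (∑ x ∈ Λ, η x) = N} := by
    intro η
    rw [Finset.mem_piAntidiag, Set.mem_ofPred_eq, and_comm]
    refine and_congr_left fun _ => forall_congr' fun x => ?_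
    rw [not_imp_comm]
  rw [tsum_eq_sum (s := Finset.piAntidiag Λ N)]
  · refine Finset.sum_congr rfl fun η hη => ?_
    unfold nuW
    rw [Set.indicator_of_mem ((hmem η).mp hη)]; rfl
  · intro η hη
    unfold nuW
    rw [Set.indicator_of_notMem (fun h => hη ((hmem η).mpr h)), zero_mul]

theorem wE_nu (c : ℕ → ℝ) (Λ : Finset ℤ) (N : ℕ) (F : (ℤ → ℕ) → ℝ) :
    wE (nuW c Λ N) F = Ex c Λ N F / Ex c Λ N (fun _ => 1) := by
  unfold wE
  rw [tsum_nu, ← tsum_nu c Λ N (fun _ => 1)]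
  simp

theorem Z_pos (c : ℕ → ℝ) (hcpos : ∀ n : ℕ, 0 < n → 0 < c n) (Λ : Finset ℤ) (N : ℕ)
    (x : ℤ) (hx : x ∈ Λ) : 0 < Ex c Λ N (fun _ => 1) := by
  unfold Ex
  refine Finset.sum_pos (fun η _ => by have := Wt_pos c hcpos Λ η; linarith) ?_
  refine ⟨fun z => if z = x then N else 0, ?_⟩
  rw [Finset.mem_piAntidiag]
  refine ⟨by simp [hx], fun i hi => ?_⟩
  by_cases h : i = x
  · rw [h]; exact hx
  · simp [h] at hi

theorem ent_nonneg (c : ℕ → ℝ) (hcpos : ∀ n : ℕ, 0 < n → 0 < c n) (Λ : Finset ℤ) (N : ℕ)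
    (x : ℤ) (hx : x ∈ Λ) (f : (ℤ → ℕ) → ℝ) (hf : ∀ η, 0 ≤ f η) : 0 ≤ wEnt (nuW c Λ N) f := by
  have hZ := Z_pos c hcpos Λ N x hx
  unfold wEnt
  rw [wE_nu, wE_nu]
  set Z := Ex c Λ N (fun _ => 1) with hZd
  have h := Real.convexOn_mul_log.map_sum_le (t := Finset.piAntidiag Λ N)
    (w := fun η => Wt c Λ η / Z) (p := f) (fun η _ => div_nonneg (Wt_pos c hcpos Λ η).le hZ.le)
    (by rw [← Finset.sum_div, div_eq_one_iff_eq hZ.ne', hZd]; unfold Ex; simp)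
    (fun η _ => hf η)
  have e : ∀ F : (ℤ → ℕ) → ℝ, ∑ η ∈ Finset.piAntidiag Λ N, (Wt c Λ η / Z) • F η = Ex c Λ N F / Z := by
    intro F
    unfold Ex
    rw [Finset.sum_div]
    exact Finset.sum_congr rfl fun η _ => by rw [smul_eq_mul]; ring
  rw [e, e (fun η => f η * Real.log (f η))] at h
  linarith

theorem final_arith (L a₁ C N ε X Y Z E K W S : ℝ) (hL : 0 < L) (ha₁ : 0 < a₁) (hC : 0 < C)
    (hN : 0 < N) (hε : 0 < ε) (hZ : 0 < Z) (hE : 0 ≤ E) (hK : 0 ≤ K) (hW : 0 ≤ W) (hS : 0 ≤ S)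
    (hX : |X| ≤ C / N * (K + L * (√N * E))) (hY : |Y| ≤ C / N * (L * (√N * Z)))
    (hKsq : K ^ 2 ≤ 2 * L ^ 3 * W * (4 * L * (a₁ * N * E))) :
    (X / Z - E / Z * (Y / Z)) ^ 2 ≤ L ^ 2 / N * (E / Z) *
      (C ^ 2 * (16 * a₁ + 8) * (E / Z) + C ^ 2 * (16 * a₁ + 8) * L ^ 2 * (W / Z) + ε * S) := by
  set q := √N with hq
  have hqq : q ^ 2 = N := Real.sq_sqrt hN.le
  have hq0 : 0 < q := Real.sqrt_pos.mpr hN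
  have e1 : |X / Z| ≤ C / N * (K / Z + L * (q * (E / Z))) := by
    rw [abs_div, abs_of_pos hZ, div_le_iff₀ hZ]
    refine hX.trans (le_of_eq ?_)
    field_simp
  have e2 : |E / Z * (Y / Z)| ≤ C / N * (L * (q * (E / Z))) := by
    rw [abs_mul, abs_of_nonneg (by positivity : 0 ≤ E / Z)]
    have : |Y / Z| ≤ C / N * (L * q) := by
      rw [abs_div, abs_of_pos hZ, div_le_iff₀ hZ]
      exact hY.trans (le_of_eq (by ring))
    refine (mul_le_mul_of_nonneg_left this (by positivity)).trans (le_of_eq (by ring))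
  have e3 : (K / Z) ^ 2 ≤ 8 * a₁ * L ^ 4 * N * (W / Z) * (E / Z) := by
    rw [div_pow, div_le_iff₀ (by positivity)]
    refine hKsq.trans (le_of_eq ?_)
    field_simp
    ring
  have he : 0 ≤ E / Z := by positivity
  have hw : 0 ≤ W / Z := by positivity
  have hk : 0 ≤ K / Z := by positivity
  generalize E / Z = e at *
  generalize W / Z = w at *
  generalize K / Z = k at *
  have e4 : |X / Z - e * (Y / Z)| ≤ C / N * (k + 2 * (L * (q * e))) := by
    refine (abs_sub _ _).trans ?_
    linarith
  have e5 : (X / Z - e * (Y / Z)) ^ 2 ≤ (C / N * (k + 2 * (L * (q * e)))) ^ 2 := by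
    rw [← sq_abs]
    exact pow_le_pow_left₀ (abs_nonneg _) e4 2
  refine e5.trans ?_
  have e6 : (k + 2 * (L * (q * e))) ^ 2 ≤ 2 * (8 * a₁ * L ^ 4 * N * w * e) + 8 * L ^ 2 * N * e ^ 2 := by
    have : (L * (q * e)) ^ 2 = L ^ 2 * N * e ^ 2 := by rw [← hqq]; ring
    nlinarith [sq_nonneg (k - 2 * (L * (q * e)))]
  rw [mul_pow]
  calc _ ≤ (C / N) ^ 2 * (2 * (8 * a₁ * L ^ 4 * N * w * e) + 8 * L ^ 2 * N * e ^ 2) := by gcongr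
    _ = L ^ 2 / N * e * (C ^ 2 * 8 * e + C ^ 2 * (16 * a₁) * L ^ 2 * w) := by field_simp; ring
    _ ≤ _ := by
        refine mul_le_mul_of_nonneg_left ?_ (by positivity)
        have i1 : 0 ≤ C ^ 2 * (16 * a₁) * e := by positivity
        have i2 : 0 ≤ C ^ 2 * 8 * L ^ 2 * w := by positivity
        have i3 : 0 ≤ ε * S := by positivity
        linarith

/-- Proposition 3.12: the two-blocks estimate for the covariance with `Σ_x h(η_x)`. -/
theorem statement14
    (c : ℕ → ℝ) (a₁ a₂ : ℝ) (k₀ : ℕ)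
    (hc0 : c 0 = 0) (hcpos : ∀ n : ℕ, 0 < n → 0 < c n)
    (hLG : ∀ k : ℕ, |c (k + 1) - c k| ≤ a₁)
    (hk₀ : 0 < k₀) (ha₂ : 0 < a₂)
    (hM : ∀ j k : ℕ, j + k₀ ≤ k → a₂ ≤ c k - c j)
    (ε : ℝ) (hε : 0 < ε) :
    ∃ Cε : ℝ, 0 < Cε ∧ ∀ (a : ℤ) (L N : ℕ), 2 ≤ L → 1 ≤ N →
      ∀ f : (ℤ → ℕ) → ℝ, (∀ η, 0 ≤ f η) →
        (wCov (nuW c (Finset.Ico a (a + (L : ℤ))) N) f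
            (fun η => ∑ x ∈ Finset.Ico a (a + (L : ℤ)), hfun c (η x))) ^ 2
          ≤ ((L : ℝ) ^ 2 / (N : ℝ)) * wE (nuW c (Finset.Ico a (a + (L : ℤ))) N) f *
              (Cε * wE (nuW c (Finset.Ico a (a + (L : ℤ))) N) f
                + Cε * (L : ℝ) ^ 2 *
                    wDir c (Finset.Ico a (a + (L : ℤ))) (nuW c (Finset.Ico a (a + (L : ℤ))) N)
                      (fun η => Real.sqrt (f η)) (fun η => Real.sqrt (f η))
                + ε * wEnt (nuW c (Finset.Ico a (a + (L : ℤ))) N) f) := by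
  obtain ⟨C, hC, H⟩ := h_lemma c a₁ a₂ k₀ hc0 hcpos hLG hk₀ ha₂ hM
  have ha₁ : 0 < a₁ := by
    have i1 := hLG 0
    have i2 := hcpos 1 one_pos
    rw [hc0, sub_zero, zero_add] at i1
    exact i2.trans_le ((le_abs_self _).trans i1)
  refine ⟨C ^ 2 * (16 * a₁ + 8), by positivity, fun a L N hL hN f hf => ?_⟩
  obtain ⟨n, rfl⟩ : ∃ n, N = n + 1 := ⟨N - 1, by omega⟩
  obtain ⟨Λ, hΛ⟩ : ∃ Λ, Λ = Finset.Ico a (a + (L : ℤ)) := ⟨_, rfl⟩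
  rw [← hΛ]
  have hcard : Λ.card = L := by rw [hΛ, Int.card_Ico]; omega
  have haΛ : a ∈ Λ := by rw [hΛ, Finset.mem_Ico]; omega
  have hEnt := ent_nonneg c hcpos Λ (n + 1) a haΛ f hf
  have hZ := Z_pos c hcpos Λ (n + 1) a haΛ
  obtain ⟨m, hm⟩ := H Λ n (by omega)
  have hX := hm f hf
  have hY := hm (fun _ => 1) (fun _ => zero_le_one)
  have hK1 : KK c Λ n (fun _ => 1) = 0 := by simp [KK, Ex]
  rw [hK1, zero_add] at hY
  have hKsq := (KK_sq c a₁ hc0 hcpos hLG Λ n f hf).trans (mul_le_mul_of_nonneg_right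
    (D0_le c hc0 hcpos a L Λ hΛ n (fun η => √(f η)))
    (mul_nonneg (by positivity) (mul_nonneg (by positivity) (Ex_nonneg c hcpos _ _ _ hf))))
  have hE : 0 ≤ Ex c Λ (n + 1) f := Ex_nonneg c hcpos _ _ _ hf
  have hK : 0 ≤ KK c Λ n f := Finset.sum_nonneg fun x _ => Finset.sum_nonneg fun y _ =>
    Ex_nonneg c hcpos _ _ _ fun _ => abs_nonneg _
  have hcov : wCov (nuW c Λ (n + 1)) f (fun η => ∑ x ∈ Λ, hfun c (η x)) =
      Ex c Λ (n + 1) (fun η => f η * ∑ x ∈ Λ, (hfun c (η x) - m)) / Ex c Λ (n + 1) (fun _ => 1) -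
      Ex c Λ (n + 1) f / Ex c Λ (n + 1) (fun _ => 1) *
      (Ex c Λ (n + 1) (fun η => 1 * ∑ x ∈ Λ, (hfun c (η x) - m)) /
        Ex c Λ (n + 1) (fun _ => 1)) := by
    have e1 : Ex c Λ (n + 1) (fun η => f η * ∑ x ∈ Λ, (hfun c (η x) - m)) =
        Ex c Λ (n + 1) (fun η => f η * ∑ x ∈ Λ, hfun c (η x)) - L * m * Ex c Λ (n + 1) f := by
      rw [← Ex_smul, ← Ex_sub]
      refine Ex_congr _ _ _ _ _ fun η _ => ?_
      rw [Finset.sum_sub_distrib, Finset.sum_const, nsmul_eq_mul, hcard]; ring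
    have e2 : Ex c Λ (n + 1) (fun η => 1 * ∑ x ∈ Λ, (hfun c (η x) - m)) =
        Ex c Λ (n + 1) (fun η => ∑ x ∈ Λ, hfun c (η x)) - L * m * Ex c Λ (n + 1) (fun _ => 1) := by
      rw [← Ex_smul, ← Ex_sub]
      refine Ex_congr _ _ _ _ _ fun η _ => ?_
      rw [Finset.sum_sub_distrib, Finset.sum_const, nsmul_eq_mul, hcard]; ring
    rw [e1, e2]
    unfold wCov
    rw [wE_nu, wE_nu, wE_nu]
    field_simp
    ring
  have hDir : wDir c Λ (nuW c Λ (n + 1)) (fun η => √(f η)) (fun η => √(f η)) =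
      Ex c Λ (n + 1) (fun η => (1 / 2) * ∑ x ∈ Λ, ∑ y ∈ Λ,
        if |x - y| = 1 then c (η x) * ((√(f (move η x y)) - √(f η)) *
          (√(f (move η x y)) - √(f η))) else 0) / Ex c Λ (n + 1) (fun _ => 1) := by
    unfold wDir
    rw [wE_nu]
  have hWD : 0 ≤ Ex c Λ (n + 1) (fun η => (1 / 2) * ∑ x ∈ Λ, ∑ y ∈ Λ,
        if |x - y| = 1 then c (η x) * ((√(f (move η x y)) - √(f η)) *
          (√(f (move η x y)) - √(f η))) else 0) := by
    refine Ex_nonneg c hcpos _ _ _ fun η => mul_nonneg (by norm_num)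
      (Finset.sum_nonneg fun x _ => Finset.sum_nonneg fun y _ => ?_)
    split_ifs
    · refine mul_nonneg ?_ (mul_self_nonneg _)
      rcases Nat.eq_zero_or_pos (η x) with h | h
      · rw [h, hc0]
      · exact (hcpos _ h).le
    · exact le_rfl
  rw [hcov, hDir, wE_nu c Λ (n + 1) f]
  rw [hcard] at hX hY hKsq
  generalize wEnt (nuW c Λ (n + 1)) f = S at *
  generalize Ex c Λ (n + 1) (fun η => (1 / 2) * ∑ x ∈ Λ, ∑ y ∈ Λ,
        if |x - y| = 1 then c (η x) * ((√(f (move η x y)) - √(f η)) *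
          (√(f (move η x y)) - √(f η))) else 0) = W at *
  generalize Ex c Λ (n + 1) (fun η => f η * ∑ x ∈ Λ, (hfun c (η x) - m)) = X at *
  generalize Ex c Λ (n + 1) (fun η => 1 * ∑ x ∈ Λ, (hfun c (η x) - m)) = Y at *
  generalize Ex c Λ (n + 1) (fun _ => 1) = Z at *
  generalize Ex c Λ (n + 1) f = E at *
  generalize KK c Λ n f = K at *
  exact final_arith L a₁ C ((n + 1 : ℕ) : ℝ) ε X Y Z E K W S (by positivity) ha₁ hC
    (by positivity) hε hZ hE hK hWD hEnt hX hY hKsq
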